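/- arXiv:2511.07342 — 3 statements merged into one kernel-verified Lean document; each statement's English description precedes it below -/
import Mathlib

section
/- Let n ≥ 1, let A = {a₁,…,a_m} ⊆ ℤⁿ be a finite nonempty set, let k ≥ 1, and let f = Σ_b c_b t^b be a real Laurent polynomial with supp(f) ⊆ k·A. Then the following are equivalent: (i) for every w ∈ ℝⁿ, writing G_w = {p ∈ conv(k·A) : ⟨w,p⟩ = min_{q ∈ conv(k·A)} ⟨w,q⟩}, one has Σ_{b ∈ G_w ∩ (k·A)} c_b t^b > 0 for all t ∈ ℝⁿ with all coordinates positive (f is strictly A-copositive); (ii) conv(supp f) = conv(k·A) and there exists M ∈ ℕ such that the Laurent polynomial (Σ_{i=1}^m t^{a_i})^M · f has support equal to (k+M)·A and the coefficient of t^b is strictly positive for every b ∈ (k+M)·A; (iii) conv(supp f) = conv(k·A) and there exists N ∈ ℕ such that every coefficient of the Laurent polynomial (Σ_{i=1}^m t^{a_i})^N · f is nonnegative. -/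
open Finset
open scoped Classical

noncomputable section

/-- Cast an integer vector to a real vector. -/
def castR {n : ℕ} (b : Fin n → ℤ) : Fin n → ℝ := fun i => (b i : ℝ)

/-- Standard scalar product on `ℝⁿ`. -/
def dotR {n : ℕ} (w p : Fin n → ℝ) : ℝ := ∑ i, w i * p i

/-- `k`-fold Minkowski sum of `A = {a 0, …, a (m-1)}`, via multiplicities. -/
def mink {n m : ℕ} (a : Fin m → Fin n → ℤ) (k : ℕ) : Set (Fin n → ℤ) :=
  {b | ∃ v : Fin m → ℕ, (∑ j, v j) = k ∧ b = ∑ j, v j • a j}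

/-- The Pólya multiplier `∑_{i=1}^m t^{a_i}` as a Laurent polynomial. -/
def polyaMul {n m : ℕ} (a : Fin m → Fin n → ℤ) : AddMonoidAlgebra ℝ (Fin n → ℤ) :=
  ∑ j, AddMonoidAlgebra.single (a j) (1 : ℝ)

/-- (i): `f` is strictly `A`-copositive — every truncation of `f` to a face of
`conv(k·A)` (given by an inner normal vector `w`) is positive on `ℝⁿ_{>0}`. -/
def stmt0CondI {n m : ℕ} (a : Fin m → Fin n → ℤ) (k : ℕ)
    (f : AddMonoidAlgebra ℝ (Fin n → ℤ)) : Prop :=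
  ∀ w t : Fin n → ℝ, (∀ i, 0 < t i) →
    0 < ∑ b ∈ f.coeff.support.filter fun b =>
          ∀ q ∈ convexHull ℝ (castR '' mink a k), dotR w (castR b) ≤ dotR w q,
        f.coeff b * ∏ i, t i ^ (b i)

/-- (ii): `Newt(f) = conv(k·A)` and some power of the Pólya multiplier times `f`
has support exactly `(k+M)·A` with all those coefficients positive. -/
def stmt0CondII {n m : ℕ} (a : Fin m → Fin n → ℤ) (k : ℕ)
    (f : AddMonoidAlgebra ℝ (Fin n → ℤ)) : Prop :=
  convexHull ℝ (castR '' (f.coeff.support : Set (Fin n → ℤ))) =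
      convexHull ℝ (castR '' mink a k) ∧
    ∃ M : ℕ,
      (((polyaMul a ^ M * f).coeff.support : Set (Fin n → ℤ)) = mink a (k + M) ∧
        ∀ b ∈ mink a (k + M), 0 < (polyaMul a ^ M * f).coeff b)

/-- (iii): `Newt(f) = conv(k·A)` and some power of the Pólya multiplier times `f`
has only nonnegative coefficients. -/
def stmt0CondIII {n m : ℕ} (a : Fin m → Fin n → ℤ) (k : ℕ)
    (f : AddMonoidAlgebra ℝ (Fin n → ℤ)) : Prop :=
  convexHull ℝ (castR '' (f.coeff.support : Set (Fin n → ℤ))) =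
      convexHull ℝ (castR '' mink a k) ∧
    ∃ N : ℕ, ∀ b : Fin n → ℤ, 0 ≤ (polyaMul a ^ N * f).coeff b

namespace SparsePolya

open MvPolynomial Topology Filter

section Polya

variable {σ : Type*} [Fintype σ]

lemma monomial_eq_prod_X_pow (v : σ →₀ ℕ) :
    (monomial v (1 : ℝ)) = ∏ i, (X i : MvPolynomial σ ℝ) ^ v i := by
  rw [monomial_eq, Finsupp.prod_fintype _ _ (by simp)]
  simp

lemma coeff_sum_X_pow (γ : σ →₀ ℕ) :
    (∏ i, ((γ i).factorial : ℝ)) * coeff γ ((∑ i, X i : MvPolynomial σ ℝ) ^ (∑ i, γ i)) =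
      ((∑ i, γ i).factorial : ℝ) := by
  have hX : ∀ v : σ → ℕ, ((Nat.multinomial univ v : ℕ) : MvPolynomial σ ℝ) *
      ∏ i, (X i : MvPolynomial σ ℝ) ^ v i =
      monomial (Finsupp.equivFunOnFinite.symm v) ((Nat.multinomial univ v : ℕ) : ℝ) := by
    intro v
    have := monomial_eq_prod_X_pow (Finsupp.equivFunOnFinite.symm v)
    simp only [Finsupp.equivFunOnFinite_symm_apply_apply] at this
    rw [← this, ← map_natCast (C (σ := σ) (R := ℝ)), C_mul_monomial, mul_one]
  rw [Finset.sum_pow_eq_sum_piAntidiag, coeff_sum, Finset.sum_eq_single (⇑γ)]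
  · rw [hX, coeff_monomial, if_pos (by ext; simp)]
    exact_mod_cast Nat.multinomial_spec univ γ
  · intro v _ hv
    rw [hX, coeff_monomial, if_neg]
    rintro rfl
    exact hv (by ext; simp)
  · intro h
    simp at h

lemma coeff_sum_X_pow_mul_monomial {M : ℕ} (α β : σ →₀ ℕ) (c : ℝ)
    (h : ∑ i, α i = M + ∑ i, β i) :
    (∏ i, ((α i).factorial : ℝ)) *
        coeff α ((∑ i, X i : MvPolynomial σ ℝ) ^ M * monomial β c) =
      M.factorial * (c * ∏ i, ((α i).descFactorial (β i) : ℝ)) := by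
  rw [coeff_mul_monomial']
  split_ifs with hle
  · have hM : ∑ i, (α - β) i = M := by
      have : ∑ i, (α - β) i + ∑ i, β i = ∑ i, α i := by
        rw [← Finset.sum_add_distrib]
        exact Finset.sum_congr rfl fun i _ => by
          rw [Finsupp.tsub_apply]; exact Nat.sub_add_cancel (hle i)
      omega
    have key := coeff_sum_X_pow (α - β)
    rw [hM] at key
    have hfac : ∏ i, ((α i).factorial : ℝ) =
        (∏ i, (((α - β) i).factorial : ℝ)) * ∏ i, ((α i).descFactorial (β i) : ℝ) := by
      rw [← Finset.prod_mul_distrib]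
      exact Finset.prod_congr rfl fun i _ => by
        rw [Finsupp.tsub_apply]; exact_mod_cast (Nat.factorial_mul_descFactorial (hle i)).symm
    rw [hfac, ← key]
    ring
  · have : ∃ i, α i < β i := by
      by_contra! hcon
      exact hle hcon
    obtain ⟨i, hi⟩ := this
    have hz : ∏ i, ((α i).descFactorial (β i) : ℝ) = 0 :=
      Finset.prod_eq_zero (mem_univ i) <| by
        exact_mod_cast Nat.descFactorial_eq_zero_iff_lt.2 hi
    simp [hz]

lemma descFactorial_cast_eq_prod {L : ℝ} (hL : L ≠ 0) (p q : ℕ) :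
    (p.descFactorial q : ℝ) = L ^ q * ∏ i ∈ range q, ((p : ℝ) / L - i * L⁻¹) := by
  induction q with
  | zero => simp
  | succ q ih =>
    have hstep : ((p - q : ℕ) : ℝ) * (p.descFactorial q : ℝ) =
        ((p : ℝ) - q) * (p.descFactorial q : ℝ) := by
      rcases le_or_gt q p with h | h
      · rw [Nat.cast_sub h]
      · rw [Nat.descFactorial_eq_zero_iff_lt.2 h]
        simp
    have hL' : (p : ℝ) - q = L * ((p : ℝ) / L - q * L⁻¹) := by
      field_simp
    rw [Nat.descFactorial_succ, Finset.prod_range_succ, Nat.cast_mul, hstep, ih, hL']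
    ring

/-- **Pólya's theorem**: a form that is positive on the standard simplex has only positive
coefficients after multiplication by a high power of the sum of the variables. -/
theorem polya {d : ℕ} {F : MvPolynomial σ ℝ} (hF : F.IsHomogeneous d)
    (hpos : ∀ x ∈ stdSimplex ℝ σ, 0 < eval x F) :
    ∃ M : ℕ, ∀ α : σ →₀ ℕ, ∑ i, α i = M + d → 0 < coeff α ((∑ i, X i) ^ M * F) := by
  let G : ℝ → (σ → ℝ) → ℝ := fun ε x =>
    ∑ β ∈ F.support, coeff β F * ∏ j, ∏ i ∈ range (β j), (x j - i * ε)
  have hG : Continuous fun z : ℝ × (σ → ℝ) => G z.1 z.2 := by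
    fun_prop
  have hev : ∀ᶠ ε in 𝓝 (0 : ℝ), ∀ x ∈ stdSimplex ℝ σ, 0 < G ε x := by
    refine (isCompact_stdSimplex ℝ σ).eventually_forall_of_forall_eventually fun x hx => ?_
    refine hG.continuousAt.eventually (lt_mem_nhds ?_)
    have := hpos x hx
    rw [eval_eq'] at this
    simpa [G] using this
  have hlim : Tendsto (fun M : ℕ => ((M + 1 + d : ℕ) : ℝ)⁻¹) atTop (𝓝 0) := by
    refine tendsto_inv_atTop_zero.comp (tendsto_natCast_atTop_atTop.comp ?_)
    exact tendsto_atTop_mono (fun M => (by omega : M ≤ M + 1 + d)) tendsto_id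
  obtain ⟨M, hM⟩ := (hlim.eventually hev).exists
  refine ⟨M + 1, fun α hα => ?_⟩
  set L : ℝ := ((M + 1 + d : ℕ) : ℝ) with hL
  have hL0 : 0 < L := by positivity
  have hx : (fun i => (α i : ℝ) / L) ∈ stdSimplex ℝ σ := by
    refine ⟨fun i => by positivity, ?_⟩
    rw [← Finset.sum_div, ← Nat.cast_sum, hα]
    exact div_self hL0.ne'
  have hsum : (∏ i, ((α i).factorial : ℝ)) * coeff α ((∑ i, X i) ^ (M + 1) * F) =
      (M + 1).factorial * (L ^ d * G L⁻¹ fun i => (α i : ℝ) / L) := by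
    conv_lhs => rw [F.as_sum, Finset.mul_sum, coeff_sum, Finset.mul_sum]
    simp only [G, Finset.mul_sum]
    refine Finset.sum_congr rfl fun β hβ => ?_
    have hβd : ∑ i, β i = d := by
      have := hF (mem_support_iff.1 hβ)
      simpa [Finsupp.weight_apply, Finsupp.sum_fintype] using this
    rw [coeff_sum_X_pow_mul_monomial α β _ (by rw [hα, hβd])]
    simp_rw [descFactorial_cast_eq_prod hL0.ne', Finset.prod_mul_distrib,
      Finset.prod_pow_eq_pow_sum, hβd]
    ring
  have hp := hM _ hx
  have h1 : 0 < ∏ i, ((α i).factorial : ℝ) := Finset.prod_pos fun i _ => by positivity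
  refine (mul_pos_iff_of_pos_left h1).1 ?_
  rw [hsum]
  positivity

end Polya

section IntegralKernel

variable {J ι : Type*} [Fintype J]

/-- Clearing denominators in a rational vector. -/
lemma exists_int_smul (q : J → ℚ) : ∃ D : ℕ, 0 < D ∧ ∃ y : J → ℤ, ∀ j, (y j : ℚ) = D * q j := by
  refine ⟨∏ j, (q j).den, Finset.prod_pos fun j _ => (q j).den_pos,
    fun j => (q j).num * ∏ i ∈ univ.erase j, ((q i).den : ℤ), fun j => ?_⟩
  rw [← Finset.mul_prod_erase univ (fun j => (q j).den) (mem_univ j)]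
  push_cast
  rw [mul_right_comm, mul_comm _ (q j), Rat.mul_den_eq_num]

/-- A real linear relation between integer vectors can be replaced by an integral one that is
positive and zero in the same places. -/
lemma exists_int_relation (b : J → ι → ℤ) (z : J → ℝ) (hz : ∀ i, ∑ j, z j * b j i = 0) :
    ∃ y : J → ℤ, (∀ i, ∑ j, y j * b j i = 0) ∧ (∀ j, 0 < z j → 0 < y j) ∧
      ∀ j, z j = 0 → y j = 0 := by
  let W : Submodule ℚ ℝ := Submodule.span ℚ (Set.range z)
  have : Module.Finite ℚ W := Module.Finite.span_of_finite ℚ (Set.finite_range z)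
  let e := Module.finBasis ℚ W
  let zW : J → W := fun j => ⟨z j, Submodule.subset_span ⟨j, rfl⟩⟩
  have hrepr : ∀ j, z j = ∑ i, (e.repr (zW j) i : ℝ) * (e i : ℝ) := by
    intro j
    have := congrArg (Subtype.val) (e.sum_repr (zW j))
    simp only [AddSubmonoidClass.coe_finsetSum, Submodule.coe_smul, Rat.smul_def] at this
    exact this.symm
  have hopen : ∀ᶠ r in 𝓝 (fun i => (e i : ℝ)), ∀ j, 0 < z j →
      0 < ∑ i, (e.repr (zW j) i : ℝ) * r i := by
    refine eventually_all.2 fun j => ?_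
    by_cases hj : 0 < z j
    · have hc : Continuous fun r : Fin (Module.finrank ℚ W) → ℝ =>
          ∑ i, (e.repr (zW j) i : ℝ) * r i := by fun_prop
      filter_upwards [hc.continuousAt.eventually (lt_mem_nhds (hrepr j ▸ hj))] with r hr _ using hr
    · exact Eventually.of_forall fun r h => absurd h hj
  have hdense : DenseRange (Pi.map fun _ : Fin (Module.finrank ℚ W) => ((↑) : ℚ → ℝ)) :=
    DenseRange.piMap fun _ => Rat.denseRange_cast
  obtain ⟨r, hr⟩ := hdense.exists_mem_open isOpen_interior ⟨_, mem_interior_iff_mem_nhds.2 hopen⟩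
  replace hr := interior_subset hr
  let φ : W →ₗ[ℚ] ℚ := e.constr ℚ r
  have hφ : ∀ j, φ (zW j) = ∑ i, e.repr (zW j) i * r i := by
    intro j
    simp [φ, Module.Basis.constr_apply_fintype]
  obtain ⟨D, hD, y, hy⟩ := exists_int_smul fun j => φ (zW j)
  have hDq : (0 : ℚ) < D := by exact_mod_cast hD
  refine ⟨y, fun i => ?_, fun j hj => ?_, fun j hj => ?_⟩
  · have hW : ∑ j, (b j i : ℚ) • zW j = 0 := by
      apply Subtype.ext
      simp only [AddSubmonoidClass.coe_finsetSum, Submodule.coe_smul, Rat.smul_def, zW]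
      rw [ZeroMemClass.coe_zero, ← hz i]
      exact Finset.sum_congr rfl fun j _ => by push_cast; ring
    have h0 : ∑ j, (b j i : ℚ) * φ (zW j) = 0 := by
      have := congrArg φ hW
      simpa [map_sum] using this
    have : (∑ j, (y j : ℚ) * b j i) = D * ∑ j, (b j i : ℚ) * φ (zW j) := by
      rw [Finset.mul_sum]
      exact Finset.sum_congr rfl fun j _ => by rw [hy]; ring
    rw [h0, mul_zero] at this
    exact_mod_cast this
  · have h1 : (0 : ℚ) < φ (zW j) := by
      have := hr j hj
      rw [hφ]
      simp only [Pi.map_apply] at this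
      exact_mod_cast this
    have : (0 : ℚ) < y j := by rw [hy]; positivity
    exact_mod_cast this
  · have h1 : zW j = 0 := Subtype.ext hj
    have : (y j : ℚ) = 0 := by rw [hy, h1]; simp
    exact_mod_cast this

variable [Fintype ι]

lemma map_eq_sum_smul_single [DecidableEq ι] {K E : Type*} [Semiring K] [AddCommMonoid E] [Module K E]
    (g : (ι → K) →ₗ[K] E) (v : ι → K) : g v = ∑ i, v i • g (Pi.single i 1) := by
  conv_lhs => rw [LinearMap.pi_apply_eq_sum_univ g v]
  refine Finset.sum_congr rfl fun i _ => ?_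
  congr 2
  ext k
  simp [Pi.single_apply, eq_comm]

/-- If the real vector `l` satisfies all integral relations of the vectors `b j`, then it is
given by a linear form evaluated at the `b j`. -/
lemma exists_linear_form_eq (b : J → ι → ℤ) (l : J → ℝ)
    (h : ∀ y : J → ℤ, (∀ i, ∑ j, y j * b j i = 0) → ∑ j, (y j : ℝ) * l j = 0) :
    ∃ τ : ι → ℝ, ∀ j, l j = ∑ i, (b j i : ℝ) * τ i := by
  let B : (J → ℚ) →ₗ[ℚ] (ι → ℚ) := Fintype.linearCombination ℚ fun j i => (b j i : ℚ)
  let Λ : (J → ℚ) →ₗ[ℚ] ℝ := Fintype.linearCombination ℚ l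
  have hker : LinearMap.ker B ≤ LinearMap.ker Λ := by
    intro q hq
    rw [LinearMap.mem_ker] at hq ⊢
    obtain ⟨D, hD, y, hy⟩ := exists_int_smul q
    have hDr : (D : ℝ) ≠ 0 := by exact_mod_cast hD.ne'
    have h1 := h y fun i => by
      have hqi := congrFun hq i
      simp only [B, Fintype.linearCombination_apply, Finset.sum_apply, Pi.smul_apply, smul_eq_mul,
        Pi.zero_apply] at hqi
      have : ∑ j, (y j : ℚ) * b j i = 0 := by
        simp_rw [hy, mul_assoc, ← Finset.mul_sum, hqi, mul_zero]
      exact_mod_cast this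
    have h2 : ∀ j, (y j : ℝ) = D * (q j : ℝ) := fun j => by exact_mod_cast hy j
    simp_rw [h2, mul_assoc, ← Finset.mul_sum] at h1
    simp only [Λ, Fintype.linearCombination_apply, Rat.smul_def]
    exact (mul_eq_zero.1 h1).resolve_left hDr
  obtain ⟨g, hg⟩ : ∃ g : (ι → ℚ) →ₗ[ℚ] ℝ, g ∘ₗ B = Λ := by
    obtain ⟨g, hg⟩ := LinearMap.exists_extend
      (((LinearMap.ker B).liftQ Λ hker) ∘ₗ B.quotKerEquivRange.symm.toLinearMap)
    refine ⟨g, LinearMap.ext fun q => ?_⟩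
    have := LinearMap.congr_fun hg ⟨B q, LinearMap.mem_range_self B q⟩
    simpa using this
  refine ⟨fun i => g (Pi.single i 1), fun j => ?_⟩
  have h1 := LinearMap.congr_fun hg (Pi.single j 1)
  simp only [LinearMap.comp_apply, B, Λ, Fintype.linearCombination_apply_single, one_smul] at h1
  rw [← h1, map_eq_sum_smul_single g]
  simp [Rat.smul_def]

/-- A form of Farkas' lemma with integral hypothesis and real conclusion: if no integral relation
of the vectors `b j` is semipositive off `S`, then some linear form vanishes at `b j` for `j ∈ S`
and is positive at the others. -/
lemma exists_linear_form_pos (b : J → ι → ℤ) (S : Set J)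
    (h : ∀ y : J → ℤ, (∀ i, ∑ j, y j * b j i = 0) → (∀ j ∉ S, 0 ≤ y j) → ∀ j ∉ S, y j = 0) :
    ∃ w : ι → ℝ, (∀ j ∈ S, ∑ i, w i * b j i = 0) ∧ ∀ j ∉ S, 0 < ∑ i, w i * b j i := by
  let B : (J → ℝ) →ₗ[ℝ] (ι → ℝ) := Fintype.linearCombination ℝ fun j i => (b j i : ℝ)
  have hB : ∀ c i, B c i = ∑ j, c j * b j i := fun c i => by
    simp [B, Fintype.linearCombination_apply, Finset.sum_apply]
  let V : Submodule ℝ (ι → ℝ) := (Submodule.pi Sᶜ fun _ => ⊥).map B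
  let K : Set (J → ℝ) := stdSimplex ℝ J ∩ {c | ∀ j ∈ S, c j = 0}
  have hKc : IsClosed {c : J → ℝ | ∀ j ∈ S, c j = 0} := by
    simp only [Set.ofPred_forall]
    exact isClosed_iInter fun j => isClosed_iInter fun _ =>
      isClosed_eq (continuous_apply j) continuous_const
  have hKconv : Convex ℝ {c : J → ℝ | ∀ j ∈ S, c j = 0} := by
    intro c hc d hd p q _ _ _ j hj
    simp [hc j hj, hd j hj]
  have hdisj : Disjoint (B '' K) (V : Set (ι → ℝ)) := by
    rw [Set.disjoint_left]
    rintro _ ⟨c, ⟨hc, hcS⟩, rfl⟩ ⟨d, hd, hdc⟩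
    have hd' : ∀ j ∉ S, d j = 0 := by
      intro j hj
      simpa using hd j hj
    obtain ⟨y, hy, hypos, hyzero⟩ := exists_int_relation b (fun j => c j - d j) fun i => by
      have := congrFun hdc i
      rw [hB, hB] at this
      simp [sub_mul, this]
    have hyS : ∀ j ∉ S, 0 ≤ y j := by
      intro j hj
      rcases (hc.1 j).eq_or_lt with h0 | h0
      · exact (hyzero j (by simp [hd' j hj, ← h0])).ge
      · exact (hypos j (by simpa [hd' j hj] using h0)).le
    have hc0 : ∀ j, c j = 0 := by
      intro j
      by_cases hj : j ∈ S
      · exact hcS j hj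
      · by_contra hne
        have h0 := (hc.1 j).lt_of_ne' hne
        exact (hypos j (by simpa [hd' j hj] using h0)).ne' (h y hy hyS j hj)
    have := hc.2
    simp [hc0] at this
  obtain ⟨f, u, v, hfu, huv, hfv⟩ := geometric_hahn_banach_compact_closed
    (((convex_stdSimplex ℝ J).inter hKconv).linear_image B)
    (((isCompact_stdSimplex ℝ J).inter_right hKc).image B.continuous_of_finiteDimensional)
    V.convex V.closed_of_finiteDimensional hdisj
  have hv0 : v < 0 := by simpa using hfv 0 V.zero_mem
  have hfV : ∀ p ∈ V, f p = 0 := by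
    intro p hp
    by_contra hne
    have := hfv ((v / f p) • p) (V.smul_mem _ hp)
    rw [map_smul, smul_eq_mul, div_mul_cancel₀ _ hne] at this
    exact lt_irrefl _ this
  have hform : ∀ j, ∑ i, -f (Pi.single i 1) * (b j i : ℝ) = -f (B (Pi.single j 1)) := by
    intro j
    rw [Fintype.linearCombination_apply_single, one_smul]
    conv_rhs => rw [← ContinuousLinearMap.coe_coe, map_eq_sum_smul_single]
    simp [mul_comm]
  refine ⟨fun i => -f (Pi.single i 1), fun j hj => ?_, fun j hj => ?_⟩
  · rw [hform, neg_eq_zero]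
    refine hfV _ ⟨_, fun i hi => ?_, rfl⟩
    have : i ≠ j := fun h => hi (h ▸ hj)
    simp [this]
  · rw [hform]
    have := hfu (B (Pi.single j 1)) ⟨_, ⟨single_mem_stdSimplex ℝ j, fun i hi => ?_⟩, rfl⟩
    · linarith
    · have : i ≠ j := fun h => hj (h ▸ hi)
      simp [this]

end IntegralKernel

section Toric

variable {n m : ℕ}

lemma dotR_sum_nsmul (a : Fin m → Fin n → ℤ) (w : Fin n → ℝ) (v : Fin m → ℕ) :
    dotR w (castR (∑ j, v j • a j)) = ∑ j, v j * dotR w (castR (a j)) := by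
  simp only [dotR, castR, Finset.sum_apply, nsmul_eq_mul, Finset.mul_sum]
  push_cast
  simp only [Finset.mul_sum]
  rw [Finset.sum_comm]
  exact Finset.sum_congr rfl fun j _ => Finset.sum_congr rfl fun i _ => by simp; ring

/-- A point of the nonnegative orthant on which all homogeneous binomials of the toric ideal of
`a` vanish lies in the relative interior of a face of the toric variety of `a`. -/
lemma exists_face_param (a : Fin m → Fin n → ℤ) (x : Fin m → ℝ) (hx : ∀ j, 0 ≤ x j)
    (H : ∀ u v : Fin m → ℕ, ∑ j, u j = ∑ j, v j → ∑ j, u j • a j = ∑ j, v j • a j →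
      ∏ j, x j ^ u j = ∏ j, x j ^ v j) :
    ∃ (w t : Fin n → ℝ) (s c : ℝ), 0 < c ∧ (∀ i, 0 < t i) ∧
      (∀ j, 0 < x j → dotR w (castR (a j)) = s ∧ x j = c * ∏ i, t i ^ a j i) ∧
      ∀ j, x j = 0 → s < dotR w (castR (a j)) := by
  let b : Fin m → Option (Fin n) → ℤ := fun j i => i.elim 1 (a j)
  have H' : ∀ y : Fin m → ℤ, (∀ i, ∑ j, y j * b j i = 0) →
      ∏ j, x j ^ (y j).toNat = ∏ j, x j ^ (-y j).toNat := by
    intro y hy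
    refine H _ _ ?_ ?_
    · have := hy none
      simp only [b, Option.elim_none, mul_one] at this
      zify
      rw [← sub_eq_zero, ← Finset.sum_sub_distrib, ← this]
      exact Finset.sum_congr rfl fun j _ => by omega
    · ext i
      have := hy (some i)
      simp only [b, Option.elim_some] at this
      rw [Finset.sum_apply, Finset.sum_apply]
      rw [← sub_eq_zero, ← Finset.sum_sub_distrib, ← this]
      refine Finset.sum_congr rfl fun j _ => ?_
      rw [Pi.smul_apply, Pi.smul_apply, nsmul_eq_mul, nsmul_eq_mul, ← sub_mul]
      congr 1
      omega
  obtain ⟨w, hw0, hwpos⟩ := exists_linear_form_pos b {j | 0 < x j} fun y hy hyS j hj => by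
    simp only [Set.mem_ofPred_eq, not_lt] at hyS hj
    by_contra hne
    have hxj : x j = 0 := le_antisymm hj (hx j)
    have hpos : 0 < ∏ j, x j ^ (-y j).toNat := by
      refine Finset.prod_pos fun i _ => ?_
      rcases (hx i).eq_or_lt with h0 | h0
      · have := hyS i h0.ge
        rw [show (-y i).toNat = 0 by omega]
        simp
      · positivity
    have hzero : ∏ j, x j ^ (y j).toNat = 0 :=
      Finset.prod_eq_zero (mem_univ j) (by
        rw [hxj, zero_pow]
        have := hyS j hj
        omega)
    rw [← H' y hy, hzero] at hpos
    exact lt_irrefl _ hpos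
  obtain ⟨τ, hτ⟩ := exists_linear_form_eq (fun j i => if 0 < x j then b j i else 0)
    (fun j => Real.log (x j)) fun y hy => by
      let y' : Fin m → ℤ := fun j => if 0 < x j then y j else 0
      have h1 := H' y' fun i => by
        rw [← hy i]
        exact Finset.sum_congr rfl fun j _ => by simp only [y']; split_ifs <;> simp
      have hne : ∀ e : ℤ → ℕ, e 0 = 0 → ∀ j ∈ univ, x j ^ e (y' j) ≠ 0 := by
        intro e he j _
        by_cases hj : 0 < x j
        · positivity
        · simp [y', hj, he]
      have h2 := congrArg Real.log h1
      rw [Real.log_prod (hne Int.toNat rfl), Real.log_prod (hne (fun z => (-z).toNat) rfl),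
        ← sub_eq_zero, ← Finset.sum_sub_distrib] at h2
      rw [← h2]
      refine Finset.sum_congr rfl fun j _ => ?_
      by_cases hj : 0 < x j
      · rw [Real.log_pow, Real.log_pow, ← sub_mul]
        congr 1
        simp only [y', if_pos hj]
        have : y j = (y j).toNat - ((-y j).toNat : ℤ) := by omega
        exact_mod_cast this
      · simp [le_antisymm (not_lt.1 hj) (hx j)]
  have hwform : ∀ j, ∑ i, w i * (b j i : ℝ) = w none + dotR (fun i => w (some i)) (castR (a j)) := by
    intro j
    simp [Fintype.sum_option, b, dotR, castR]
  refine ⟨fun i => w (some i), fun i => Real.exp (τ (some i)), -w none, Real.exp (τ none),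
    Real.exp_pos _, fun i => Real.exp_pos _, fun j hj => ⟨?_, ?_⟩, fun j hj => ?_⟩
  · have := hw0 j hj
    rw [hwform] at this
    linarith
  · rw [← Real.exp_log hj, hτ j]
    simp only [if_pos hj, Fintype.sum_option, b, Option.elim_none, Option.elim_some, Real.exp_add,
      Real.exp_sum, Int.cast_one, one_mul]
    congr 1
    refine Finset.prod_congr rfl fun i _ => ?_
    rw [mul_comm, Real.exp_mul, Real.rpow_intCast]
  · have := hwpos j (by simp [hj])
    rw [hwform] at this
    linarith

lemma le_dotR_convexHull {s : Set (Fin n → ℝ)} {w : Fin n → ℝ} {r : ℝ}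
    (h : ∀ q ∈ s, r ≤ dotR w q) : ∀ q ∈ convexHull ℝ s, r ≤ dotR w q := by
  have hlin : IsLinearMap ℝ (dotR w) :=
    ⟨fun p q => by simp [dotR, mul_add, Finset.sum_add_distrib],
      fun c p => by simp [dotR, Finset.mul_sum, mul_left_comm]⟩
  exact fun q hq => convexHull_min h (convex_halfSpace_ge hlin r) hq

/-- Strict copositivity gives positivity of any lift of `f` at the nonnegative points of the toric
variety. -/
lemma pos_of_condI {k : ℕ} {a : Fin m → Fin n → ℤ} {f : AddMonoidAlgebra ℝ (Fin n → ℤ)}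
    (hI : stmt0CondI a k f) (rep : (Fin n → ℤ) → Fin m → ℕ)
    (hrep : ∀ b ∈ f.coeff.support, ∑ j, rep b j = k ∧ b = ∑ j, rep b j • a j)
    {x : Fin m → ℝ} (hx : x ∈ stdSimplex ℝ (Fin m))
    (H : ∀ u v : Fin m → ℕ, ∑ j, u j = ∑ j, v j → ∑ j, u j • a j = ∑ j, v j • a j →
      ∏ j, x j ^ u j = ∏ j, x j ^ v j) :
    0 < ∑ b ∈ f.coeff.support, f.coeff b * ∏ j, x j ^ rep b j := by
  obtain ⟨w, t, s, c, hc, ht, hface, hoff⟩ := exists_face_param a x hx.1 H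
  have hs : ∀ j, s ≤ dotR w (castR (a j)) := fun j => by
    rcases (hx.1 j).eq_or_lt with h | h
    · exact (hoff j h.symm).le
    · exact (hface j h).1.ge
  obtain ⟨j₀, hj₀⟩ : ∃ j, 0 < x j := by
    by_contra! hcon
    have : ∑ j, x j ≤ 0 := Finset.sum_nonpos fun j _ => hcon j
    linarith [hx.2]
  have hmin : ∀ q ∈ convexHull ℝ (castR '' mink a k), k * s ≤ dotR w q := by
    refine le_dotR_convexHull ?_
    rintro _ ⟨_, ⟨v, hv, rfl⟩, rfl⟩
    rw [dotR_sum_nsmul, ← hv, Nat.cast_sum, Finset.sum_mul]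
    exact Finset.sum_le_sum fun j _ => mul_le_mul_of_nonneg_left (hs j) (Nat.cast_nonneg _)
  have hmem : castR (∑ j, (Pi.single j₀ k : Fin m → ℕ) j • a j) ∈
      convexHull ℝ (castR '' mink a k) :=
    subset_convexHull ℝ _ ⟨_, ⟨_, by simp, rfl⟩, rfl⟩
  have hval : dotR w (castR (∑ j, (Pi.single j₀ k : Fin m → ℕ) j • a j)) = k * s := by
    rw [dotR_sum_nsmul, Finset.sum_eq_single j₀ (by intro j _ hj; simp [hj]) (by simp),
      Pi.single_eq_same, (hface j₀ hj₀).1]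
  have hpos := mul_pos (pow_pos hc k) (hI w t ht)
  rw [Finset.mul_sum, Finset.sum_filter] at hpos
  refine hpos.trans_eq (Finset.sum_congr rfl fun b hb => ?_)
  obtain ⟨hk, hbv⟩ := hrep b hb
  have hdb : dotR w (castR b) = k * s + ∑ j, rep b j * (dotR w (castR (a j)) - s) := by
    conv_lhs => rw [hbv, dotR_sum_nsmul]
    simp_rw [mul_sub, Finset.sum_sub_distrib, ← Finset.sum_mul, ← Nat.cast_sum, hk]
    ring
  have hterm : ∀ j, 0 ≤ (rep b j : ℝ) * (dotR w (castR (a j)) - s) := fun j =>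
    mul_nonneg (Nat.cast_nonneg _) (sub_nonneg.2 (hs j))
  split_ifs with hb'
  · have hzero : ∑ j, (rep b j : ℝ) * (dotR w (castR (a j)) - s) = 0 := by
      refine le_antisymm ?_ (Finset.sum_nonneg fun j _ => hterm j)
      have := hb' _ hmem
      rw [hval, hdb] at this
      linarith
    have hprod : ∏ j, x j ^ rep b j = ∏ j, (c * ∏ i, t i ^ a j i) ^ rep b j := by
      refine Finset.prod_congr rfl fun j _ => ?_
      rcases (hx.1 j).eq_or_lt with h | h
      · have h1 := (Finset.sum_eq_zero_iff_of_nonneg fun j _ => hterm j).1 hzero j (mem_univ j)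
        have h2 : (rep b j : ℝ) = 0 :=
          (mul_eq_zero.1 h1).resolve_right (sub_pos.2 (hoff j h.symm)).ne'
        have h3 : rep b j = 0 := by exact_mod_cast h2
        simp [h3]
      · rw [← (hface j h).2]
    have ht' : ∏ i, t i ^ b i = ∏ j, (∏ i, t i ^ a j i) ^ rep b j := by
      simp_rw [← Finset.prod_pow]
      rw [Finset.prod_comm]
      refine Finset.prod_congr rfl fun i _ => ?_
      have : b i = ∑ j, a j i * rep b j := by
        conv_lhs => rw [hbv]
        simp [Finset.sum_apply, mul_comm]
      rw [this, ← Real.rpow_intCast, Int.cast_sum, Real.rpow_sum_of_pos (ht i)]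
      refine Finset.prod_congr rfl fun j _ => ?_
      rw [Real.rpow_intCast, zpow_mul, zpow_natCast]
    rw [hprod, ht']
    simp_rw [mul_pow, Finset.prod_mul_distrib, Finset.prod_pow_eq_pow_sum, hk]
    ring
  · have : ∃ j, x j = 0 ∧ rep b j ≠ 0 := by
      by_contra! hcon
      refine hb' fun q hq => le_trans (le_of_eq ?_) (hmin q hq)
      rw [hdb, add_eq_left]
      refine Finset.sum_eq_zero fun j _ => ?_
      rcases (hx.1 j).eq_or_lt with h | h
      · simp [hcon j h.symm]
      · simp [(hface j h).1]
    obtain ⟨j, hj, hj'⟩ := this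
    rw [Finset.prod_eq_zero (mem_univ j) (by rw [hj, zero_pow hj']), mul_zero]

end Toric

section Lift

variable {n m : ℕ}

/-- The substitution `X j ↦ t ^ a j`. -/
def toLaurent (a : Fin m → Fin n → ℤ) :
    MvPolynomial (Fin m) ℝ →ₐ[ℝ] AddMonoidAlgebra ℝ (Fin n → ℤ) :=
  aeval fun j => AddMonoidAlgebra.single (a j) 1

lemma toLaurent_sum_X (a : Fin m → Fin n → ℤ) : toLaurent a (∑ j, X j) = polyaMul a := by
  simp [toLaurent, polyaMul]

lemma toLaurent_monomial (a : Fin m → Fin n → ℤ) (v : Fin m →₀ ℕ) (c : ℝ) :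
    toLaurent a (monomial v c) = AddMonoidAlgebra.single (∑ j, v j • a j) c := by
  rw [toLaurent, aeval_monomial, Finsupp.prod_fintype _ _ (by simp)]
  have : ∀ s : Finset (Fin m), ∏ j ∈ s, (AddMonoidAlgebra.single (a j) (1 : ℝ)) ^ v j =
      AddMonoidAlgebra.single (∑ j ∈ s, v j • a j) 1 := by
    intro s
    induction s using Finset.induction_on with
    | empty => simp [AddMonoidAlgebra.one_def]
    | insert j s hj ih =>
      rw [Finset.prod_insert hj, Finset.sum_insert hj, ih, AddMonoidAlgebra.single_pow,
        AddMonoidAlgebra.single_mul_single]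
      simp
  rw [this, ← Algebra.smul_def, AddMonoidAlgebra.smul_single, smul_eq_mul, mul_one]

lemma coeff_toLaurent (a : Fin m → Fin n → ℤ) (G : MvPolynomial (Fin m) ℝ) (b : Fin n → ℤ) :
    (toLaurent a G).coeff b =
      ∑ v ∈ G.support, if ∑ j, v j • a j = b then coeff v G else 0 := by
  conv_lhs => rw [G.as_sum, map_sum]
  simp only [toLaurent_monomial, AddMonoidAlgebra.coeff_sum, Finsupp.finsetSum_apply,
    AddMonoidAlgebra.coeff_single, Finsupp.single_apply]

lemma sum_eq_of_isHomogeneous {d : ℕ} {G : MvPolynomial (Fin m) ℝ} (hG : G.IsHomogeneous d)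
    {v : Fin m →₀ ℕ} (hv : v ∈ G.support) : ∑ j, v j = d := by
  simpa [Finsupp.weight_apply, Finsupp.sum_fintype] using hG (mem_support_iff.1 hv)

lemma coeff_toLaurent_eq_zero {a : Fin m → Fin n → ℤ} {d : ℕ} {G : MvPolynomial (Fin m) ℝ}
    (hG : G.IsHomogeneous d) {b : Fin n → ℤ} (hb : b ∉ mink a d) :
    (toLaurent a G).coeff b = 0 := by
  rw [coeff_toLaurent]
  refine Finset.sum_eq_zero fun v hv => if_neg fun h => hb ?_
  exact ⟨v, sum_eq_of_isHomogeneous hG hv, h.symm⟩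

lemma coeff_toLaurent_pos {a : Fin m → Fin n → ℤ} {d : ℕ} {G : MvPolynomial (Fin m) ℝ}
    (hG : G.IsHomogeneous d) (hpos : ∀ v : Fin m →₀ ℕ, ∑ j, v j = d → 0 < coeff v G)
    {b : Fin n → ℤ} (hb : b ∈ mink a d) : 0 < (toLaurent a G).coeff b := by
  obtain ⟨v, hv, rfl⟩ := hb
  have hvpos := hpos (Finsupp.equivFunOnFinite.symm v) (by simpa using hv)
  rw [coeff_toLaurent]
  refine Finset.sum_pos' (fun u hu => ?_)
    ⟨Finsupp.equivFunOnFinite.symm v, mem_support_iff.2 hvpos.ne', by simpa using hvpos⟩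
  split_ifs
  · exact (hpos u (sum_eq_of_isHomogeneous hG hu)).le
  · exact le_rfl

lemma isHomogeneous_sum_X : (∑ j, X j : MvPolynomial (Fin m) ℝ).IsHomogeneous 1 :=
  IsHomogeneous.sum _ _ _ fun j _ => isHomogeneous_X ℝ j

lemma isHomogeneous_sum_X_pow (d : ℕ) :
    ((∑ j, X j : MvPolynomial (Fin m) ℝ) ^ d).IsHomogeneous d := by
  simpa using isHomogeneous_sum_X.pow d

lemma eval_sum_X {x : Fin m → ℝ} (hx : x ∈ stdSimplex ℝ (Fin m)) :
    eval x (∑ j, X j) = 1 := by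
  simpa using hx.2

/-- A form that is positive at the nonnegative points of the toric variety of `a` becomes
positive on the whole simplex after adding a suitable element of the toric ideal. -/
lemma exists_isHomogeneous_eval_add_pos (a : Fin m → Fin n → ℤ) (F : MvPolynomial (Fin m) ℝ)
    (hF : ∀ x ∈ stdSimplex ℝ (Fin m),
      (∀ u v : Fin m → ℕ, ∑ j, u j = ∑ j, v j → ∑ j, u j • a j = ∑ j, v j • a j →
        ∏ j, x j ^ u j = ∏ j, x j ^ v j) → 0 < eval x F) :
    ∃ (e : ℕ) (Q : MvPolynomial (Fin m) ℝ), Q.IsHomogeneous e ∧ toLaurent a Q = 0 ∧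
      ∀ x ∈ stdSimplex ℝ (Fin m), 0 < eval x F + eval x Q := by
  suffices h : ∃ (e : ℕ) (Q : MvPolynomial (Fin m) ℝ), Q.IsHomogeneous e ∧ toLaurent a Q = 0 ∧
      (∀ x ∈ stdSimplex ℝ (Fin m), 0 ≤ eval x Q) ∧
      ∀ x ∈ stdSimplex ℝ (Fin m) ∩ stdSimplex ℝ (Fin m), 0 < eval x F + eval x Q by
    obtain ⟨e, Q, hQ, hQ0, -, hpos⟩ := h
    exact ⟨e, Q, hQ, hQ0, fun x hx => hpos x ⟨hx, hx⟩⟩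
  refine (isCompact_stdSimplex ℝ (Fin m)).induction_on
    (p := fun s => ∃ (e : ℕ) (Q : MvPolynomial (Fin m) ℝ), Q.IsHomogeneous e ∧
      toLaurent a Q = 0 ∧ (∀ x ∈ stdSimplex ℝ (Fin m), 0 ≤ eval x Q) ∧
      ∀ x ∈ s ∩ stdSimplex ℝ (Fin m), 0 < eval x F + eval x Q) ?_ ?_ ?_ ?_
  · exact ⟨0, 0, isHomogeneous_zero _ _ _, by simp, by simp, by simp⟩
  · rintro s t hst ⟨e, Q, hQ, hQ0, hnn, hpos⟩
    exact ⟨e, Q, hQ, hQ0, hnn, fun x hx => hpos x ⟨hst hx.1, hx.2⟩⟩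
  · rintro s t ⟨e, Q, hQ, hQ0, hnn, hpos⟩ ⟨e', Q', hQ', hQ0', hnn', hpos'⟩
    have hev : ∀ x ∈ stdSimplex ℝ (Fin m),
        eval x (Q * (∑ j, X j) ^ e' + (∑ j, X j) ^ e * Q') = eval x Q + eval x Q' := by
      intro x hx
      rw [map_add, map_mul, map_mul, map_pow, map_pow, eval_sum_X hx]
      simp
    refine ⟨e + e', Q * (∑ j, X j) ^ e' + (∑ j, X j) ^ e * Q',
      (hQ.mul (isHomogeneous_sum_X_pow e')).add ((isHomogeneous_sum_X_pow e).mul hQ'),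
      by rw [map_add, map_mul, map_mul, hQ0, hQ0']; simp, fun x hx => ?_, ?_⟩
    · rw [hev x hx]
      exact add_nonneg (hnn x hx) (hnn' x hx)
    · rintro x ⟨hx | hx, hxs⟩
      · rw [hev x hxs]
        linarith [hpos x ⟨hx, hxs⟩, hnn' x hxs]
      · rw [hev x hxs]
        linarith [hpos' x ⟨hx, hxs⟩, hnn x hxs]
  · intro x hx
    suffices h : ∃ (e : ℕ) (Q : MvPolynomial (Fin m) ℝ), Q.IsHomogeneous e ∧
        toLaurent a Q = 0 ∧ (∀ x ∈ stdSimplex ℝ (Fin m), 0 ≤ eval x Q) ∧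
        0 < eval x F + eval x Q by
      obtain ⟨e, Q, hQ, hQ0, hnn, hpos⟩ := h
      refine ⟨{y | 0 < eval y F + eval y Q}, mem_nhdsWithin_of_mem_nhds ?_,
        e, Q, hQ, hQ0, hnn, fun y hy => hy.1⟩
      have hc : Continuous fun y => eval y F + eval y Q :=
        (continuous_eval F).add (continuous_eval Q)
      exact hc.continuousAt.eventually (lt_mem_nhds hpos)
    by_cases hFx : 0 < eval x F
    · exact ⟨0, 0, isHomogeneous_zero _ _ _, by simp, by simp, by simpa using hFx⟩
    · obtain ⟨u, v, huv, huva, hne⟩ : ∃ u v : Fin m → ℕ, ∑ j, u j = ∑ j, v j ∧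
          ∑ j, u j • a j = ∑ j, v j • a j ∧ ∏ j, x j ^ u j ≠ ∏ j, x j ^ v j := by
        by_contra! hcon
        exact hFx (hF x hx hcon)
      let h : MvPolynomial (Fin m) ℝ := monomial (Finsupp.equivFunOnFinite.symm u) 1 -
        monomial (Finsupp.equivFunOnFinite.symm v) 1
      have hh : h.IsHomogeneous (∑ j, u j) :=
        (isHomogeneous_monomial _ (by simp [Finsupp.degree_eq_sum])).sub
          (isHomogeneous_monomial _ (by simp [Finsupp.degree_eq_sum, huv]))
      have hh0 : toLaurent a h = 0 := by
        simp only [h, map_sub, toLaurent_monomial, Finsupp.equivFunOnFinite_symm_apply_apply, huva,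
          sub_self]
      have hhx : eval x h ≠ 0 := by
        simpa [h, eval_monomial, Finsupp.prod_fintype, sub_eq_zero] using hne
      have hsq : 0 < eval x h ^ 2 := by positivity
      refine ⟨_, C ((1 - eval x F) / eval x h ^ 2) * h ^ 2, (hh.pow 2).C_mul _,
        by rw [map_mul, map_pow, hh0]; simp, fun y _ => ?_, ?_⟩
      · rw [map_mul, eval_C, map_pow]
        have : 0 ≤ 1 - eval x F := by linarith
        positivity
      · rw [map_mul, eval_C, map_pow, div_mul_cancel₀ _ hsq.ne']
        linarith

theorem exists_coeff_pos_of_condI {k : ℕ} {a : Fin m → Fin n → ℤ}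
    {f : AddMonoidAlgebra ℝ (Fin n → ℤ)}
    (hsupp : (f.coeff.support : Set (Fin n → ℤ)) ⊆ mink a k) (hI : stmt0CondI a k f) :
    ∃ M : ℕ, ((polyaMul a ^ M * f).coeff.support : Set (Fin n → ℤ)) = mink a (k + M) ∧
      ∀ b ∈ mink a (k + M), 0 < (polyaMul a ^ M * f).coeff b := by
  have hex : ∀ b, ∃ v : Fin m → ℕ,
      b ∈ f.coeff.support → ∑ j, v j = k ∧ b = ∑ j, v j • a j := by
    intro b
    by_cases hb : b ∈ f.coeff.support
    · obtain ⟨v, hv⟩ := hsupp hb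
      exact ⟨v, fun _ => hv⟩
    · exact ⟨0, fun h => absurd h hb⟩
  choose rep hrep using hex
  let F : MvPolynomial (Fin m) ℝ :=
    ∑ b ∈ f.coeff.support, monomial (Finsupp.equivFunOnFinite.symm (rep b)) (f.coeff b)
  have hFhom : F.IsHomogeneous k := IsHomogeneous.sum _ _ _ fun b hb =>
    isHomogeneous_monomial _ (by simpa [Finsupp.degree_eq_sum] using (hrep b hb).1)
  have hFf : toLaurent a F = f := by
    simp only [F, map_sum, toLaurent_monomial, Finsupp.equivFunOnFinite_symm_apply_apply]
    conv_rhs => rw [← AddMonoidAlgebra.sum_coeff_single f]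
    exact Finset.sum_congr rfl fun b hb => by rw [← (hrep b hb).2]
  have hFeval : ∀ x, eval x F = ∑ b ∈ f.coeff.support, f.coeff b * ∏ j, x j ^ rep b j := by
    intro x
    simp [F, eval_monomial, Finsupp.prod_fintype]
  obtain ⟨e, Q, hQ, hQ0, hpos⟩ := exists_isHomogeneous_eval_add_pos a F fun x hx H => by
    rw [hFeval]
    exact pos_of_condI hI rep hrep hx H
  let G := F * (∑ j, X j) ^ e + (∑ j, X j) ^ k * Q
  have hG : G.IsHomogeneous (k + e) :=
    (hFhom.mul (isHomogeneous_sum_X_pow e)).add ((isHomogeneous_sum_X_pow k).mul hQ)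
  obtain ⟨M, hM⟩ := polya hG fun x hx => by
    have := hpos x hx
    simp only [G]
    rw [map_add, map_mul, map_mul, map_pow, map_pow, eval_sum_X hx]
    simpa using this
  have hGM : ((∑ j, X j) ^ M * G).IsHomogeneous (k + (M + e)) := by
    rw [show k + (M + e) = M + (k + e) by omega]
    exact (isHomogeneous_sum_X_pow M).mul hG
  have hGf : toLaurent a ((∑ j, X j) ^ M * G) = polyaMul a ^ (M + e) * f := by
    simp only [G]
    rw [map_mul, map_add, map_mul, map_mul, map_pow, map_pow, toLaurent_sum_X, hQ0, hFf]
    ring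
  have hcoeff : ∀ b ∈ mink a (k + (M + e)), 0 < (polyaMul a ^ (M + e) * f).coeff b := by
    intro b hb
    rw [← hGf]
    exact coeff_toLaurent_pos hGM (fun v hv => hM v (by omega)) hb
  refine ⟨M + e, Set.Subset.antisymm (fun b hb => ?_) (fun b hb => ?_), hcoeff⟩
  · by_contra hb'
    rw [Finset.mem_coe, Finsupp.mem_support_iff, ← hGf] at hb
    exact hb (coeff_toLaurent_eq_zero hGM hb')
  · exact Finsupp.mem_support_iff.2 (hcoeff b hb).ne'

theorem convexHull_eq_of_condI {k : ℕ} {a : Fin m → Fin n → ℤ}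
    {f : AddMonoidAlgebra ℝ (Fin n → ℤ)}
    (hsupp : (f.coeff.support : Set (Fin n → ℤ)) ⊆ mink a k) (hI : stmt0CondI a k f) :
    convexHull ℝ (castR '' (f.coeff.support : Set (Fin n → ℤ))) =
      convexHull ℝ (castR '' mink a k) := by
  refine Set.Subset.antisymm (convexHull_mono (Set.image_mono hsupp)) ?_
  refine convexHull_min ?_ (convex_convexHull ℝ _)
  rintro _ ⟨b, hb, rfl⟩
  by_contra hnot
  obtain ⟨g, u, hgb, hgu⟩ := geometric_hahn_banach_point_closed (convex_convexHull ℝ _)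
    ((f.coeff.support.finite_toSet.image castR).isCompact_convexHull ℝ).isClosed hnot
  have hg : ∀ q, g q = dotR (fun i => g (Pi.single i 1)) q := by
    intro q
    rw [← ContinuousLinearMap.coe_coe, map_eq_sum_smul_single]
    simp [dotR, mul_comm]
  have h0 := hI (fun i => g (Pi.single i 1)) (fun _ => 1) fun _ => one_pos
  rw [Finset.filter_false_of_mem] at h0
  · simp at h0
  · intro c hc hcmin
    have h1 := hcmin _ (subset_convexHull ℝ _ ⟨b, hb, rfl⟩)
    rw [← hg, ← hg] at h1
    have h2 := hgu _ (subset_convexHull ℝ _ ⟨c, hc, rfl⟩)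
    linarith

end Lift

section InitialForm

variable {n m : ℕ}

/-- The part of `f` supported on the hyperplane `⟨w, b⟩ = r`. -/
def trunc (w : Fin n → ℝ) (r : ℝ) (f : AddMonoidAlgebra ℝ (Fin n → ℤ)) :
    AddMonoidAlgebra ℝ (Fin n → ℤ) :=
  .ofCoeff (f.coeff.filter fun b => dotR w (castR b) = r)

lemma coeff_trunc (w : Fin n → ℝ) (r : ℝ) (f : AddMonoidAlgebra ℝ (Fin n → ℤ))
    (b : Fin n → ℤ) :
    (trunc w r f).coeff b = if dotR w (castR b) = r then f.coeff b else 0 := by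
  simp [trunc, Finsupp.filter_apply]

lemma dotR_castR_add (w : Fin n → ℝ) (b c : Fin n → ℤ) :
    dotR w (castR (b + c)) = dotR w (castR b) + dotR w (castR c) := by
  simp [dotR, castR, mul_add, Finset.sum_add_distrib]

lemma trunc_mul {w : Fin n → ℝ} {r s : ℝ} {f g : AddMonoidAlgebra ℝ (Fin n → ℤ)}
    (hf : ∀ b ∈ f.coeff.support, r ≤ dotR w (castR b))
    (hg : ∀ b ∈ g.coeff.support, s ≤ dotR w (castR b)) :
    trunc w (r + s) (f * g) = trunc w r f * trunc w s g := by
  ext b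
  have hsub : ∀ (r : ℝ) (f : AddMonoidAlgebra ℝ (Fin n → ℤ)),
      (trunc w r f).coeff.support ⊆ f.coeff.support := by
    intro r f b hb
    rw [Finsupp.mem_support_iff, coeff_trunc] at hb
    exact Finsupp.mem_support_iff.2 fun h => hb (by simp [h])
  rw [coeff_trunc, AddMonoidAlgebra.coeff_mul, AddMonoidAlgebra.coeff_mul,
    Finsupp.sum_of_support_subset _ (hsub r f) _ (by simp), Finsupp.sum, Finset.ite_sum_zero]
  refine Finset.sum_congr rfl fun c hc => ?_
  rw [Finsupp.sum_of_support_subset _ (hsub s g) _ (by simp), Finsupp.sum, Finset.ite_sum_zero]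
  refine Finset.sum_congr rfl fun d hd => ?_
  by_cases hb : c + d = b
  · subst hb
    have hc' := hf c hc
    have hd' := hg d hd
    simp only [if_true, coeff_trunc, dotR_castR_add]
    by_cases h1 : dotR w (castR c) = r
    · simp [h1]
    · have h2 : dotR w (castR c) + dotR w (castR d) ≠ r + s := fun h =>
        h1 (le_antisymm (by linarith) hc')
      simp [h1, h2]
  · simp [hb]

lemma le_of_mem_support_mul {w : Fin n → ℝ} {r s : ℝ} {f g : AddMonoidAlgebra ℝ (Fin n → ℤ)}
    (hf : ∀ b ∈ f.coeff.support, r ≤ dotR w (castR b))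
    (hg : ∀ b ∈ g.coeff.support, s ≤ dotR w (castR b)) :
    ∀ b ∈ (f * g).coeff.support, r + s ≤ dotR w (castR b) := by
  intro b hb
  obtain ⟨c, hc, d, hd, rfl⟩ := Finset.mem_add.1 (AddMonoidAlgebra.support_coeff_mul_subset f g hb)
  rw [dotR_castR_add]
  exact add_le_add (hf c hc) (hg d hd)

lemma trunc_pow_mul {w : Fin n → ℝ} {r s : ℝ} {f g : AddMonoidAlgebra ℝ (Fin n → ℤ)}
    (hf : ∀ b ∈ f.coeff.support, r ≤ dotR w (castR b))
    (hg : ∀ b ∈ g.coeff.support, s ≤ dotR w (castR b)) (N : ℕ) :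
    (∀ b ∈ (f ^ N * g).coeff.support, N * r + s ≤ dotR w (castR b)) ∧
      trunc w (N * r + s) (f ^ N * g) = trunc w r f ^ N * trunc w s g := by
  induction N with
  | zero => simpa using hg
  | succ N ih =>
    have h : ((N + 1 : ℕ) : ℝ) * r + s = r + (N * r + s) := by push_cast; ring
    rw [h, pow_succ', pow_succ', mul_assoc, mul_assoc, ← ih.2]
    exact ⟨le_of_mem_support_mul hf ih.1, trunc_mul hf ih.1⟩

/-- Evaluation of Laurent polynomials at a positive point. -/
def evalPos (t : Fin n → ℝ) (ht : ∀ i, 0 < t i) : AddMonoidAlgebra ℝ (Fin n → ℤ) →ₐ[ℝ] ℝ :=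
  AddMonoidAlgebra.lift ℝ ℝ (Fin n → ℤ)
    { toFun := fun b => ∏ i, t i ^ (b.toAdd i)
      map_one' := by simp
      map_mul' := fun b c => by
        simp [zpow_add₀ (ht _).ne', Finset.prod_mul_distrib] }

lemma evalPos_apply {t : Fin n → ℝ} (ht : ∀ i, 0 < t i) (f : AddMonoidAlgebra ℝ (Fin n → ℤ)) :
    evalPos t ht f = ∑ b ∈ f.coeff.support, f.coeff b * ∏ i, t i ^ b i := by
  simp [evalPos, AddMonoidAlgebra.lift_apply, Finsupp.sum]

lemma evalPos_pos {t : Fin n → ℝ} (ht : ∀ i, 0 < t i) {f : AddMonoidAlgebra ℝ (Fin n → ℤ)}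
    (hf : f ≠ 0) (hnn : ∀ b, 0 ≤ f.coeff b) : 0 < evalPos t ht f := by
  rw [evalPos_apply]
  refine Finset.sum_pos (fun b hb => ?_) ?_
  · exact mul_pos ((hnn b).lt_of_ne' (Finsupp.mem_support_iff.1 hb))
      (Finset.prod_pos fun i _ => zpow_pos (ht i) _)
  · rw [Finsupp.support_nonempty_iff]
    simpa using hf

lemma coeff_polyaMul (a : Fin m → Fin n → ℤ) (b : Fin n → ℤ) :
    (polyaMul a).coeff b = ∑ j, if a j = b then 1 else 0 := by
  simp only [polyaMul, AddMonoidAlgebra.coeff_sum, Finsupp.finsetSum_apply,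
    AddMonoidAlgebra.coeff_single, Finsupp.single_apply]

theorem condI_of_condIII {k : ℕ} (hm : 1 ≤ m) {a : Fin m → Fin n → ℤ}
    {f : AddMonoidAlgebra ℝ (Fin n → ℤ)} (hIII : stmt0CondIII a k f) : stmt0CondI a k f := by
  obtain ⟨hconv, N, hN⟩ := hIII
  intro w t ht
  have : Nonempty (Fin m) := ⟨⟨0, hm⟩⟩
  have hne : f.coeff.support.Nonempty := by
    have h1 : (castR '' mink a k).Nonempty :=
      ⟨_, _, ⟨Pi.single (Classical.arbitrary _) k, by simp, rfl⟩, rfl⟩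
    rw [← convexHull_nonempty_iff (𝕜 := ℝ), ← hconv, convexHull_nonempty_iff,
      Set.image_nonempty] at h1
    exact_mod_cast h1
  obtain ⟨b₀, hb₀, hmin⟩ := Finset.exists_min_image f.coeff.support
    (fun b => dotR w (castR b)) hne
  obtain ⟨j₀, -, hjmin⟩ := Finset.exists_min_image univ
    (fun j => dotR w (castR (a j))) Finset.univ_nonempty
  set r := dotR w (castR (a j₀))
  set s := dotR w (castR b₀)
  have hface : ∀ b ∈ f.coeff.support,
      ((∀ q ∈ convexHull ℝ (castR '' mink a k), dotR w (castR b) ≤ dotR w q) ↔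
        dotR w (castR b) = s) := by
    intro b hb
    rw [← hconv]
    refine ⟨fun h => le_antisymm (h _ (subset_convexHull ℝ _ ⟨b₀, hb₀, rfl⟩)) (hmin b hb),
      fun h => le_dotR_convexHull ?_⟩
    rintro _ ⟨c, hc, rfl⟩
    exact h.trans_le (hmin c hc)
  have hp : ∀ b ∈ (polyaMul a).coeff.support, r ≤ dotR w (castR b) := by
    intro b hb
    rw [Finsupp.mem_support_iff, coeff_polyaMul] at hb
    obtain ⟨j, -, hj⟩ := Finset.exists_ne_zero_of_sum_ne_zero hb
    have : a j = b := by
      by_contra h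
      simp [h] at hj
    exact this ▸ hjmin j (mem_univ j)
  have hpnn : ∀ b, 0 ≤ (polyaMul a).coeff b := fun b => by
    rw [coeff_polyaMul]
    exact Finset.sum_nonneg fun j _ => by split_ifs <;> simp
  have hp0 : trunc w r (polyaMul a) ≠ 0 := by
    intro h
    have h1 : (trunc w r (polyaMul a)).coeff (a j₀) = 0 := by simp [h]
    rw [coeff_trunc, if_pos rfl, coeff_polyaMul] at h1
    have h2 : (0 : ℝ) < ∑ j, if a j = a j₀ then 1 else 0 :=
      Finset.sum_pos' (fun j _ => by split_ifs <;> simp) ⟨j₀, mem_univ _, by simp⟩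
    exact h2.ne' h1
  have hf0 : trunc w s f ≠ 0 := by
    intro h
    have h1 : (trunc w s f).coeff b₀ = 0 := by simp [h]
    rw [coeff_trunc, if_pos rfl] at h1
    exact Finsupp.mem_support_iff.1 hb₀ h1
  have htr : ∀ (q : ℝ) {g : AddMonoidAlgebra ℝ (Fin n → ℤ)}, (∀ b, 0 ≤ g.coeff b) →
      ∀ b, 0 ≤ (trunc w q g).coeff b := by
    intro q g hg b
    rw [coeff_trunc]
    split_ifs
    exacts [hg b, le_rfl]
  have hprod := (trunc_pow_mul hp hmin N).2
  have hpos := evalPos_pos ht (hprod ▸ mul_ne_zero (pow_ne_zero N hp0) hf0) (htr _ hN)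
  rw [hprod, map_mul, map_pow] at hpos
  have hppos := pow_pos (evalPos_pos ht hp0 (htr r hpnn)) N
  have hfpos := (mul_pos_iff_of_pos_left hppos).1 hpos
  rw [evalPos_apply] at hfpos
  refine hfpos.trans_eq ?_
  rw [Finset.filter_congr hface]
  refine Finset.sum_congr ?_ fun b hb => ?_
  · simp [trunc, Finsupp.support_filter]
  · rw [coeff_trunc, if_pos (Finset.mem_filter.1 hb).2]

end InitialForm

end SparsePolya

/-- Sparse Pólya theorem (Theorem 3.5 of the paper). -/
theorem sparse_polya {n m k : ℕ} (hn : 1 ≤ n) (hm : 1 ≤ m) (hk : 1 ≤ k)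
    (a : Fin m → Fin n → ℤ) (f : AddMonoidAlgebra ℝ (Fin n → ℤ))
    (hsupp : (f.coeff.support : Set (Fin n → ℤ)) ⊆ mink a k) :
    (stmt0CondI a k f ↔ stmt0CondII a k f) ∧
      (stmt0CondII a k f ↔ stmt0CondIII a k f) := by
  have h12 : stmt0CondI a k f → stmt0CondII a k f := fun h =>
    ⟨SparsePolya.convexHull_eq_of_condI hsupp h, SparsePolya.exists_coeff_pos_of_condI hsupp h⟩
  have h23 : stmt0CondII a k f → stmt0CondIII a k f := by
    rintro ⟨hconv, M, hM, hpos⟩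
    refine ⟨hconv, M, fun b => ?_⟩
    by_cases hb : b ∈ mink a (k + M)
    · exact (hpos b hb).le
    · rw [← hM, Finset.mem_coe, Finsupp.notMem_support_iff] at hb
      exact hb.ge
  have h31 : stmt0CondIII a k f → stmt0CondI a k f := SparsePolya.condI_of_condIII hm
  exact ⟨⟨h12, fun h => h31 (h23 h)⟩, ⟨h23, fun h => h12 (h31 h)⟩⟩
end
end

section
/- Let n ≥ 1, A = {a₁,…,a_m} ⊆ ℤⁿ finite nonempty, k ≥ 1, and let f = Σ_b c_b t^b be a real Laurent polynomial with supp(f) ⊆ k·A. Let φ : ℝ^{n+1}_{>0} → ℝ^m, φ(u,t) = (u·t^{a₁},…,u·t^{a_m}), and Y⁺ ⊆ ℝ^m the Euclidean closure of its image. Let V be any function assigning to each b ∈ k·A a vector v_b ∈ ℕ^m with Σ_j (v_b)_j a_j = b and Σ_j (v_b)_j = k, and set f̂(y) = Σ_{b∈k·A} c_b ∏_j y_j^{(v_b)_j}. Then the following are equivalent: (ii) f̂(y) > 0 for all y ∈ Y⁺ \ {0}; (iii) for every w ∈ ℝⁿ, writing F_w = {a ∈ A : ⟨w,a⟩ = min_{a'∈A}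 ⟨w,a'⟩}, one has Σ_{b ∈ k·F_w} c_b t^b > 0 for all t ∈ ℝⁿ_{>0}; (iv) for every w ∈ ℝⁿ, writing G_w = {p ∈ conv(k·A) : ⟨w,p⟩ = min over conv(k·A)}, one has Σ_{b ∈ G_w ∩ (k·A)} c_b t^b > 0 for all t ∈ ℝⁿ_{>0}. -/
open Finset
open scoped Classical

noncomputable section

lemma dotR_castR_sum_nsmul {n m : ℕ} (w : Fin n → ℝ) (a : Fin m → Fin n → ℤ) (v : Fin m → ℕ) :
    dotR w (castR (∑ j, v j • a j)) = ∑ j, (v j : ℝ) * dotR w (castR (a j)) := by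
  simp only [dotR, castR, Finset.sum_apply, nsmul_eq_mul, Finset.mul_sum]
  push_cast
  simp only [Finset.mul_sum]
  rw [Finset.sum_comm]
  refine Finset.sum_congr rfl fun j _ => Finset.sum_congr rfl fun i _ => ?_
  simp
  ring

/-- `⟨w, ·⟩` is minimal at the point `a j` among all points of the configuration `a`. -/
def IsMinimizer {n m : ℕ} (w : Fin n → ℝ) (a : Fin m → Fin n → ℤ) (j : Fin m) : Prop :=
  ∀ j', dotR w (castR (a j)) ≤ dotR w (castR (a j'))

lemma exists_isMinimizer {n m : ℕ} (hm : 1 ≤ m) (w : Fin n → ℝ) (a : Fin m → Fin n → ℤ) :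
    ∃ j, IsMinimizer w a j := by
  have : Nonempty (Fin m) := ⟨⟨0, hm⟩⟩
  exact Finite.exists_min fun j => dotR w (castR (a j))

/-- A weighted sum of points has value at least the total weight times the minimum. -/
lemma IsMinimizer.mul_le_dotR_sum {n m : ℕ} {w : Fin n → ℝ} {a : Fin m → Fin n → ℤ} {j₀ : Fin m}
    (h : IsMinimizer w a j₀) (v : Fin m → ℕ) :
    ((∑ j, v j : ℕ) : ℝ) * dotR w (castR (a j₀)) ≤ dotR w (castR (∑ j, v j • a j)) := by
  rw [dotR_castR_sum_nsmul, Nat.cast_sum, Finset.sum_mul]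
  exact Finset.sum_le_sum fun j _ => mul_le_mul_of_nonneg_left (h j) (Nat.cast_nonneg _)

/-- Equality in `IsMinimizer.mul_le_dotR_sum` holds exactly for combinations of minimizers. -/
lemma IsMinimizer.dotR_sum_eq_iff {n m : ℕ} {w : Fin n → ℝ} {a : Fin m → Fin n → ℤ} {j₀ : Fin m}
    (h : IsMinimizer w a j₀) (v : Fin m → ℕ) :
    ((∑ j, v j : ℕ) : ℝ) * dotR w (castR (a j₀)) = dotR w (castR (∑ j, v j • a j)) ↔
      ∀ j, v j ≠ 0 → IsMinimizer w a j := by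
  rw [dotR_castR_sum_nsmul, Nat.cast_sum, Finset.sum_mul, Finset.sum_eq_sum_iff_of_le
    fun j _ => mul_le_mul_of_nonneg_left (h j) (Nat.cast_nonneg _)]
  refine forall_congr' fun j => ?_
  constructor
  · intro H hj j'
    have := mul_left_cancel₀ (Nat.cast_ne_zero.mpr hj) (H (Finset.mem_univ j))
    exact this ▸ h j'
  · intro H _
    rcases eq_or_ne (v j) 0 with hj | hj
    · simp [hj]
    · rw [le_antisymm (h j) (H hj j₀)]

/-- Lying in the `k`-fold sum of the minimizers can be tested on any single decomposition. -/
lemma exists_minimizer_decomposition_iff {n m k : ℕ} (hm : 1 ≤ m) (w : Fin n → ℝ)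
    (a : Fin m → Fin n → ℤ) {b : Fin n → ℤ} {v : Fin m → ℕ} (hv : ∑ j, v j = k)
    (hb : ∑ j, v j • a j = b) :
    (∃ v' : Fin m → ℕ, (∑ j, v' j) = k ∧ b = ∑ j, v' j • a j ∧
      ∀ j, v' j ≠ 0 → IsMinimizer w a j) ↔ ∀ j, v j ≠ 0 → IsMinimizer w a j := by
  obtain ⟨j₀, h₀⟩ := exists_isMinimizer hm w a
  constructor
  · rintro ⟨v', hv', hb', H⟩
    rw [← h₀.dotR_sum_eq_iff] at H ⊢
    rw [hv, hb, hb', ← H, hv']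
  · exact fun H => ⟨v, hv, hb.symm, H⟩

/-- Minimality of a point of `k·A` over `conv(k·A)` means being a sum of `k` minimizers in `A`. -/
lemma forall_mem_convexHull_dotR_le_iff {n m k : ℕ} (hm : 1 ≤ m) (w : Fin n → ℝ)
    (a : Fin m → Fin n → ℤ) {B : Set (Fin n → ℤ)}
    (hB : B = {b | ∃ v : Fin m → ℕ, (∑ j, v j) = k ∧ b = ∑ j, v j • a j})
    {b : Fin n → ℤ} {v : Fin m → ℕ} (hv : ∑ j, v j = k) (hb : ∑ j, v j • a j = b) :
    (∀ q ∈ convexHull ℝ (castR '' B), dotR w (castR b) ≤ dotR w q) ↔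
      ∀ j, v j ≠ 0 → IsMinimizer w a j := by
  obtain ⟨j₀, h₀⟩ := exists_isMinimizer hm w a
  rw [← h₀.dotR_sum_eq_iff, hv, hb]
  constructor
  · intro H
    refine le_antisymm (hb ▸ hv ▸ h₀.mul_le_dotR_sum v) ?_
    have hmem : ∑ j, (Pi.single j₀ k : Fin m → ℕ) j • a j ∈ B := by
      rw [hB]
      exact ⟨Pi.single j₀ k, by simp, rfl⟩
    refine (H _ (subset_convexHull ℝ _ ⟨_, hmem, rfl⟩)).trans_eq ?_
    rw [dotR_castR_sum_nsmul, Finset.sum_eq_single j₀] <;> simp +contextual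
  · intro H
    have hconv : Convex ℝ {q | dotR w (castR b) ≤ dotR w q} := by
      refine convex_halfSpace_ge ⟨fun x y => ?_, fun c x => ?_⟩ _
      · simp [dotR, mul_add, Finset.sum_add_distrib]
      · simp only [dotR, Pi.smul_apply, smul_eq_mul, Finset.mul_sum]
        exact Finset.sum_congr rfl fun i _ => by ring
    suffices hsub : castR '' B ⊆ {q | dotR w (castR b) ≤ dotR w q} from
      fun q hq => convexHull_min hsub hconv hq
    rintro _ ⟨b', hb', rfl⟩
    rw [hB] at hb'
    obtain ⟨v', hv', rfl⟩ := hb'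
    change dotR w (castR b) ≤ _
    rw [← H, ← hv']
    exact h₀.mul_le_dotR_sum v'

lemma zpow_sum₀ {ι K : Type*} [Field K] {x : K} (hx : x ≠ 0) (s : Finset ι) (e : ι → ℤ) :
    x ^ ∑ i ∈ s, e i = ∏ i ∈ s, x ^ e i := by
  induction s using Finset.induction_on with
  | empty => simp
  | insert i s hi ih => rw [Finset.sum_insert hi, Finset.prod_insert hi, zpow_add₀ hx, ih]

lemma prod_mul_monomial_pow {n m : ℕ} (a : Fin m → Fin n → ℤ) (u : ℝ) {t : Fin n → ℝ}
    (ht : ∀ i, 0 < t i) (v : Fin m → ℕ) :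
    ∏ j, (u * ∏ i, t i ^ a j i) ^ v j = u ^ (∑ j, v j) * ∏ i, t i ^ (∑ j, v j • a j) i := by
  simp only [mul_pow, Finset.prod_mul_distrib, Finset.prod_pow_eq_pow_sum, ← Finset.prod_pow]
  rw [Finset.prod_comm]
  congr 1
  refine Finset.prod_congr rfl fun i _ => ?_
  rw [Finset.sum_apply, zpow_sum₀ (ht i).ne']
  refine Finset.prod_congr rfl fun j _ => ?_
  rw [Pi.smul_apply, nsmul_eq_mul, mul_comm, zpow_mul, zpow_natCast]

/-- On the torus orbit of a face, `f̂` is a power of `u` times the truncation of `f`. -/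
lemma sum_coeff_mul_prod_pow_eq {n m k : ℕ} (hm : 1 ≤ m) (a : Fin m → Fin n → ℤ)
    (B : Finset (Fin n → ℤ)) (c : (Fin n → ℤ) → ℝ) (V : (Fin n → ℤ) → Fin m → ℕ)
    (hV : ∀ b ∈ B, (∑ j, V b j) = k ∧ (∑ j, V b j • a j) = b)
    (w : Fin n → ℝ) (u : ℝ) {t : Fin n → ℝ} (ht : ∀ i, 0 < t i) :
    ∑ b ∈ B, c b * ∏ j, (if IsMinimizer w a j then u * ∏ i, t i ^ a j i else 0) ^ V b j =
      u ^ k * ∑ b ∈ B.filter fun b => ∃ v : Fin m → ℕ, (∑ j, v j) = k ∧ b = ∑ j, v j • a j ∧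
          ∀ j, v j ≠ 0 → IsMinimizer w a j,
        c b * ∏ i, t i ^ b i := by
  rw [Finset.sum_filter, Finset.mul_sum]
  refine Finset.sum_congr rfl fun b hb => ?_
  obtain ⟨hk, hsum⟩ := hV b hb
  rw [exists_minimizer_decomposition_iff hm w a hk hsum]
  split_ifs with H
  · have : ∏ j, (if IsMinimizer w a j then u * ∏ i, t i ^ a j i else 0) ^ V b j =
        ∏ j, (u * ∏ i, t i ^ a j i) ^ V b j := by
      refine Finset.prod_congr rfl fun j _ => ?_
      rcases eq_or_ne (V b j) 0 with hj | hj
      · simp [hj]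
      · rw [if_pos (H j hj)]
    rw [this, prod_mul_monomial_pow a u ht, hk, hsum]
    ring
  · push Not at H
    obtain ⟨j, hj, hmin⟩ := H
    rw [Finset.prod_eq_zero (Finset.mem_univ j) (by rw [if_neg hmin, zero_pow hj])]
    simp

/-- The linear map `(c, x) ↦ (c + ⟨a_j, x⟩)_j`, i.e. the monomial map in logarithmic coordinates. -/
def logMonomialMap {n m : ℕ} (a : Fin m → Fin n → ℤ) : ℝ × (Fin n → ℝ) →ₗ[ℝ] Fin m → ℝ where
  toFun z := fun j => z.1 + dotR z.2 (castR (a j))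
  map_add' x y := by
    ext j
    simp only [dotR, Prod.fst_add, Prod.snd_add, Pi.add_apply, add_mul, Finset.sum_add_distrib]
    ring
  map_smul' r x := by
    ext j
    simp [dotR, mul_add, Finset.mul_sum, mul_assoc]

lemma logMonomialMap_apply {n m : ℕ} (a : Fin m → Fin n → ℤ) (z : ℝ × (Fin n → ℝ)) (j : Fin m) :
    logMonomialMap a z j = z.1 + dotR z.2 (castR (a j)) := rfl

lemma exp_logMonomialMap {n m : ℕ} (a : Fin m → Fin n → ℤ) (z : ℝ × (Fin n → ℝ)) (j : Fin m) :
    Real.exp (logMonomialMap a z j) = Real.exp z.1 * ∏ i, Real.exp (z.2 i) ^ a j i := by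
  rw [logMonomialMap_apply, Real.exp_add, dotR, Real.exp_sum]
  congr 1
  refine Finset.prod_congr rfl fun i _ => ?_
  rw [castR, Real.exp_mul, Real.rpow_intCast]

/-- The image of the monomial map consists of exponentials of `logMonomialMap`. -/
lemma setOf_monomial_eq_range {n m : ℕ} (a : Fin m → Fin n → ℤ) :
    {y : Fin m → ℝ | ∃ u : ℝ, ∃ t : Fin n → ℝ,
        0 < u ∧ (∀ i, 0 < t i) ∧ y = fun j => u * ∏ i, t i ^ (a j i)} =
      Set.range fun z : ℝ × (Fin n → ℝ) => fun j => Real.exp (logMonomialMap a z j) := by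
  ext y
  constructor
  · rintro ⟨u, t, hu, ht, rfl⟩
    refine ⟨(Real.log u, fun i => Real.log (t i)), ?_⟩
    ext j
    simp [exp_logMonomialMap, Real.exp_log hu, Real.exp_log (ht _)]
  · rintro ⟨z, rfl⟩
    exact ⟨Real.exp z.1, fun i => Real.exp (z.2 i), Real.exp_pos _, fun i => Real.exp_pos _,
      funext fun j => exp_logMonomialMap a z j⟩

/-- Every linear map of vector spaces has a generalized inverse. -/
lemma LinearMap.exists_comp_comp_eq {K E F : Type*} [Field K] [AddCommGroup E] [Module K E]
    [AddCommGroup F] [Module K F] (T : E →ₗ[K] F) : ∃ g : F →ₗ[K] E, ∀ x, T (g (T x)) = T x := by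
  obtain ⟨g, hg⟩ := T.rangeRestrict.exists_rightInverse_of_surjective T.range_rangeRestrict
  obtain ⟨g', hg'⟩ := g.exists_extend
  refine ⟨g', fun x => ?_⟩
  have h1 : g' (T x) = g (T.rangeRestrict x) := LinearMap.congr_fun hg' (T.rangeRestrict x)
  rw [h1]
  exact congrArg Subtype.val (LinearMap.congr_fun hg (T.rangeRestrict x))

open Filter Topology in
/-- A nonzero limit of exponentials of vectors in a linear image is supported where some vector of
the image vanishes, this vector being negative elsewhere, and agrees there with such an
exponential. -/
lemma exists_of_mem_closure_range_exp {m : ℕ} {E : Type*} [AddCommGroup E] [Module ℝ E]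
    (T : E →ₗ[ℝ] Fin m → ℝ) {y : Fin m → ℝ}
    (hy : y ∈ closure (Set.range fun z : E => fun j => Real.exp (T z j))) :
    ∃ x z : E, ∀ j, (T x j = 0 ∧ y j = Real.exp (T z j)) ∨ (T x j < 0 ∧ y j = 0) := by
  obtain ⟨s, hs, hlim⟩ := mem_closure_iff_seq_limit.mp hy
  choose ζ hζ using hs
  have hlimj : ∀ j, Tendsto (fun r => Real.exp (T (ζ r) j)) atTop (𝓝 (y j)) := by
    intro j
    refine (tendsto_pi_nhds.mp hlim j).congr fun r => ?_
    rw [← hζ r]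
  have hnonneg : ∀ j, 0 ≤ y j := fun j =>
    ge_of_tendsto' (hlimj j) fun r => (Real.exp_pos _).le
  let P : (Fin m → ℝ) →ₗ[ℝ] Fin m → ℝ :=
    LinearMap.pi fun j => if y j = 0 then 0 else LinearMap.proj j
  have hP0 : ∀ x j, y j = 0 → P x j = 0 := fun x j hj => by simp [P, hj]
  have hP1 : ∀ x j, y j ≠ 0 → P x j = x j := fun x j hj => by simp [P, hj]
  obtain ⟨g, hg⟩ := (P ∘ₗ T).exists_comp_comp_eq
  simp only [LinearMap.comp_apply] at hg
  have hlog : Tendsto (fun r => P (T (ζ r))) atTop (𝓝 fun j => Real.log (y j)) := by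
    refine tendsto_pi_nhds.mpr fun j => ?_
    by_cases hj : y j = 0
    · simp [hP0 _ j hj, hj]
    · simp only [hP1 _ j hj]
      exact ((hlimj j).log hj).congr fun r => Real.log_exp _
  have hTg : Tendsto (fun r => T (g (P (T (ζ r))))) atTop (𝓝 (T (g fun j => Real.log (y j)))) :=
    ((T ∘ₗ g).continuous_of_finiteDimensional.tendsto _).comp hlog
  have hz : P (T (g fun j => Real.log (y j))) = fun j => Real.log (y j) := by
    refine tendsto_nhds_unique ((P.continuous_of_finiteDimensional.tendsto _).comp hTg) ?_
    exact hlog.congr fun r => (hg _).symm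
  have hneg : ∀ j, y j = 0 → ∀ᶠ r in atTop, T (ζ r - g (P (T (ζ r)))) j < 0 := by
    intro j hj
    have h1 : Tendsto (fun r => T (ζ r) j) atTop atBot := by
      rw [← Real.tendsto_exp_comp_nhds_zero]
      exact hj ▸ hlimj j
    have h2 := (h1.atBot_add (tendsto_pi_nhds.mp hTg j).neg).eventually_lt_atBot 0
    filter_upwards [h2] with r hr
    simpa [sub_eq_add_neg] using hr
  obtain ⟨r, hr⟩ := (eventually_all.mpr fun j => eventually_imp_distrib_left.mpr (hneg j)).exists
  refine ⟨ζ r - g (P (T (ζ r))), g fun j => Real.log (y j), fun j => ?_⟩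
  by_cases hj : y j = 0
  · exact Or.inr ⟨hr j hj, hj⟩
  · refine Or.inl ⟨?_, ?_⟩
    · rw [← hP1 (T _) j hj, map_sub, map_sub, hg, sub_self, Pi.zero_apply]
    · rw [← hP1 (T _) j hj, hz, Real.exp_log ((hnonneg j).lt_of_ne (Ne.symm hj))]

/-- Every nonzero point of the nonnegative toric variety lies in the torus orbit of a face. -/
lemma exists_eq_of_mem_closure_range_exp_logMonomialMap {n m : ℕ} (a : Fin m → Fin n → ℤ)
    {y : Fin m → ℝ}
    (hy : y ∈ closure (Set.range fun z : ℝ × (Fin n → ℝ) => fun j =>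
      Real.exp (logMonomialMap a z j))) (hy0 : y ≠ 0) :
    ∃ (w : Fin n → ℝ) (z : ℝ × (Fin n → ℝ)),
      y = fun j => if IsMinimizer w a j then Real.exp (logMonomialMap a z j) else 0 := by
  obtain ⟨x, z, H⟩ := exists_of_mem_closure_range_exp _ hy
  obtain ⟨j₀, hj₀⟩ := Function.ne_iff.mp hy0
  have h0 : logMonomialMap a x j₀ = 0 :=
    (H j₀).elim And.left fun h => absurd h.2 hj₀
  have hneg : ∀ j, dotR (-x.2) (castR (a j)) = x.1 - logMonomialMap a x j := by
    intro j
    simp [logMonomialMap_apply, dotR]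
  have hle : ∀ j, logMonomialMap a x j ≤ 0 := fun j => (H j).elim (·.1.le) (·.1.le)
  refine ⟨-x.2, z, funext fun j => ?_⟩
  rcases H j with ⟨hx, hyj⟩ | ⟨hx, hyj⟩
  · rw [if_pos, hyj]
    intro j'
    rw [hneg, hneg]
    linarith [hle j']
  · rw [if_neg, hyj]
    intro hmin
    have := hmin j₀
    rw [hneg, hneg] at this
    linarith

open Filter Topology in
/-- The torus orbit of every face lies in the nonnegative toric variety. -/
lemma mem_closure_range_exp_logMonomialMap {n m : ℕ} (hm : 1 ≤ m) (a : Fin m → Fin n → ℤ)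
    (w : Fin n → ℝ) (z : ℝ × (Fin n → ℝ)) :
    (fun j => if IsMinimizer w a j then Real.exp (logMonomialMap a z j) else 0) ∈
      closure (Set.range fun z : ℝ × (Fin n → ℝ) => fun j =>
        Real.exp (logMonomialMap a z j)) := by
  obtain ⟨j₀, h₀⟩ := exists_isMinimizer hm w a
  let x : ℝ × (Fin n → ℝ) := (dotR w (castR (a j₀)), -w)
  have hx : ∀ j, logMonomialMap a x j = dotR w (castR (a j₀)) - dotR w (castR (a j)) := by
    intro j
    simp [x, logMonomialMap_apply, dotR, sub_eq_add_neg]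
  refine mem_closure_of_tendsto (b := atTop)
    (f := fun r : ℝ => fun j => Real.exp (logMonomialMap a (z + r • x) j)) ?_
    (Eventually.of_forall fun r => ⟨_, rfl⟩)
  refine tendsto_pi_nhds.mpr fun j => ?_
  simp only [map_add, map_smul, Pi.add_apply, Pi.smul_apply, smul_eq_mul, hx]
  split_ifs with hj
  · rw [le_antisymm (h₀ j) (hj j₀)]
    simp
  · refine Real.tendsto_exp_atBot.comp (tendsto_atBot_add_const_left _ _ ?_)
    refine tendsto_id.atTop_mul_const_of_neg (sub_neg.mpr ?_)
    by_contra! hle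
    exact hj fun l => hle.trans (h₀ l)

/-- Proposition 2.5: strict `A`-copositivity (positivity of `f̂` on the punctured
nonnegative toric variety) is equivalent to positivity of all face truncations. -/
theorem strictA_copositive_iff_truncations
    {n m k : ℕ} (hn : 1 ≤ n) (hm : 1 ≤ m) (hk : 1 ≤ k)
    (a : Fin m → Fin n → ℤ)
    -- `B` is the `k`-fold Minkowski sum `k·A`
    (B : Finset (Fin n → ℤ))
    (hB : (B : Set (Fin n → ℤ)) =
      {b | ∃ v : Fin m → ℕ, (∑ j, v j) = k ∧ b = ∑ j, v j • a j})
    -- the Laurent polynomial `f` with support contained in `k·A`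
    (f : AddMonoidAlgebra ℝ (Fin n → ℤ))
    (hsupp : (f.coeff.support : Set (Fin n → ℤ)) ⊆ (B : Set (Fin n → ℤ)))
    -- `V` assigns to each `b ∈ k·A` a decomposition `b = ∑ v_j a_j`, `∑ v_j = k`
    (V : (Fin n → ℤ) → Fin m → ℕ)
    (hV : ∀ b ∈ B, (∑ j, V b j) = k ∧ (∑ j, V b j • a j) = b)
    -- `Yplus` is the Euclidean closure of the image of the monomial map `φ_Â`
    (Yplus : Set (Fin m → ℝ))
    (hY : Yplus = closure {y : Fin m → ℝ | ∃ u : ℝ, ∃ t : Fin n → ℝ,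
        0 < u ∧ (∀ i, 0 < t i) ∧ y = fun j => u * ∏ i, t i ^ (a j i)}) :
    -- (ii) ↔ (iii)
    ((∀ y ∈ Yplus, y ≠ 0 → 0 < ∑ b ∈ B, f.coeff b * ∏ j, y j ^ V b j) ↔
      (∀ w : Fin n → ℝ, ∀ t : Fin n → ℝ, (∀ i, 0 < t i) →
        0 < ∑ b ∈ B.filter fun b =>
              -- `b ∈ k·F_w`, where `F_w ⊆ A` is the set of minimizers of `⟨w,·⟩` on `A`
              ∃ v : Fin m → ℕ, (∑ j, v j) = k ∧ b = ∑ j, v j • a j ∧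
                ∀ j, v j ≠ 0 → ∀ j', dotR w (castR (a j)) ≤ dotR w (castR (a j')),
            f.coeff b * ∏ i, t i ^ (b i)))
    ∧
    -- (iii) ↔ (iv)
    ((∀ w : Fin n → ℝ, ∀ t : Fin n → ℝ, (∀ i, 0 < t i) →
        0 < ∑ b ∈ B.filter fun b =>
              ∃ v : Fin m → ℕ, (∑ j, v j) = k ∧ b = ∑ j, v j • a j ∧
                ∀ j, v j ≠ 0 → ∀ j', dotR w (castR (a j)) ≤ dotR w (castR (a j')),
            f.coeff b * ∏ i, t i ^ (b i)) ↔
      (∀ w : Fin n → ℝ, ∀ t : Fin n → ℝ, (∀ i, 0 < t i) →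
        0 < ∑ b ∈ B.filter fun b =>
              -- `b` lies on the face `G_w` of `conv(k·A)` with inner normal `w`
              ∀ q ∈ convexHull ℝ (castR '' (B : Set (Fin n → ℤ))),
                dotR w (castR b) ≤ dotR w q,
            f.coeff b * ∏ i, t i ^ (b i))) := by
  refine ⟨⟨fun H w t ht => ?_, fun H y hy hy0 => ?_⟩, forall_congr' fun w => forall₂_congr
    fun t _ => ?_⟩
  · let z : ℝ × (Fin n → ℝ) := (0, fun i => Real.log (t i))
    have hz : ∀ j, Real.exp (logMonomialMap a z j) = 1 * ∏ i, t i ^ a j i := fun j => by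
      simp [z, exp_logMonomialMap, Real.exp_log (ht _)]
    obtain ⟨j₀, h₀⟩ := exists_isMinimizer hm w a
    have hpos := H (fun j => if IsMinimizer w a j then Real.exp (logMonomialMap a z j) else 0)
      (by rw [hY, setOf_monomial_eq_range]; exact mem_closure_range_exp_logMonomialMap hm a w z)
      (Function.ne_iff.mpr ⟨j₀, by simp [h₀, Real.exp_ne_zero]⟩)
    simp only [hz] at hpos
    rw [sum_coeff_mul_prod_pow_eq hm a B f.coeff V hV w 1 ht, one_pow, one_mul] at hpos
    exact hpos
  · rw [hY, setOf_monomial_eq_range] at hy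
    obtain ⟨w, z, rfl⟩ := exists_eq_of_mem_closure_range_exp_logMonomialMap a hy hy0
    have ht : ∀ i, 0 < Real.exp (z.2 i) := fun i => Real.exp_pos _
    simp only [exp_logMonomialMap]
    rw [sum_coeff_mul_prod_pow_eq hm a B f.coeff V hV w _ ht]
    exact mul_pos (pow_pos (Real.exp_pos _) k) (H w _ ht)
  · refine iff_of_eq (congrArg (0 < ·) (Finset.sum_congr (Finset.filter_congr fun b hb => ?_)
      fun _ _ => rfl))
    obtain ⟨hk, hsum⟩ := hV b hb
    exact (exists_minimizer_decomposition_iff hm w a hk hsum).trans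
      (forall_mem_convexHull_dotR_le_iff hm w a hB hk hsum).symm
end
end

section
/- Let A = {a₁,…,a_m} ⊆ ℤⁿ be a finite nonempty set. Inside the Laurent polynomial ring ℝ[ℤⁿ], let R be the ℝ-subalgebra generated by the monomials t^{a₁},…,t^{a_m}, let S = {g ∈ ℝ[ℤⁿ] : every coefficient of g is ≥ 0 and supp(g) is contained in the additive submonoid of ℤⁿ generated by A} (equivalently, the set of finite ℝ_{≥0}-linear combinations of products of the t^{a_i}), and let T = {g + h·(1 − Σ_{i=1}^m t^{a_i}) : g ∈ S, h ∈ R}. Then T is an Archimedean preprime of R: T + T ⊆ T, T·T ⊆ T, all nonnegative rational constants lie in T, and for every f ∈ R there exists N ∈ ℕ such that N + f ∈ T and N − f ∈ T. -/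
open Finset

noncomputable section

/-- The subalgebra `R = ℝ[t^{a₁},…,t^{a_m}]` of the Laurent polynomial ring. -/
def monomialSubalgebra {n m : ℕ} (a : Fin m → Fin n → ℤ) :
    Subalgebra ℝ (AddMonoidAlgebra ℝ (Fin n → ℤ)) :=
  Algebra.adjoin ℝ (Set.range fun j => AddMonoidAlgebra.single (a j) (1 : ℝ))

/-- `S`: Laurent polynomials with nonnegative coefficients supported in the
additive submonoid generated by `A`. -/
def nonnegPart {n m : ℕ} (a : Fin m → Fin n → ℤ) :
    Set (AddMonoidAlgebra ℝ (Fin n → ℤ)) :=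
  {g | (∀ b, 0 ≤ g.coeff b) ∧
    (g.coeff.support : Set (Fin n → ℤ)) ⊆ (AddSubmonoid.closure (Set.range a) : Set (Fin n → ℤ))}

/-- The preprime `T = S + (1 − ∑ t^{a_i})·R`. -/
def polyaPreprime {n m : ℕ} (a : Fin m → Fin n → ℤ) :
    Set (AddMonoidAlgebra ℝ (Fin n → ℤ)) :=
  {p | ∃ g ∈ nonnegPart a, ∃ h ∈ monomialSubalgebra a, p = g + h * (1 - polyaMul a)}

section

variable {n m : ℕ} {a : Fin m → Fin n → ℤ} {p q : AddMonoidAlgebra ℝ (Fin n → ℤ)}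

lemma add_mem_nonnegPart (hp : p ∈ nonnegPart a) (hq : q ∈ nonnegPart a) :
    p + q ∈ nonnegPart a := by
  classical
  refine ⟨fun b => add_nonneg (hp.1 b) (hq.1 b), fun b hb => ?_⟩
  rcases Finset.mem_union.1 (Finsupp.support_add hb) with h | h
  exacts [hp.2 h, hq.2 h]

lemma mul_mem_nonnegPart (hp : p ∈ nonnegPart a) (hq : q ∈ nonnegPart a) :
    p * q ∈ nonnegPart a := by
  classical
  refine ⟨fun b => ?_, fun b hb => ?_⟩
  · rw [AddMonoidAlgebra.coeff_mul]
    refine Finset.sum_nonneg fun c _ => Finset.sum_nonneg fun d _ => ?_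
    dsimp only
    split_ifs
    exacts [mul_nonneg (hp.1 c) (hq.1 d), le_rfl]
  · obtain ⟨c, hc, d, hd, rfl⟩ :=
      Finset.mem_add.1 (AddMonoidAlgebra.support_coeff_mul_subset p q hb)
    exact add_mem (hp.2 hc) (hq.2 hd)

lemma single_mem_nonnegPart {b : Fin n → ℤ} (hb : b ∈ AddSubmonoid.closure (Set.range a))
    {r : ℝ} (hr : 0 ≤ r) : AddMonoidAlgebra.single b r ∈ nonnegPart a := by
  classical
  refine ⟨fun c => ?_, fun c hc => ?_⟩
  · rw [AddMonoidAlgebra.coeff_single, Finsupp.single_apply]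
    split_ifs
    exacts [hr, le_rfl]
  · rw [Finset.mem_singleton.1 (Finsupp.support_single_subset hc)]
    exact hb

lemma algebraMap_mem_nonnegPart {r : ℝ} (hr : 0 ≤ r) :
    algebraMap ℝ (AddMonoidAlgebra ℝ (Fin n → ℤ)) r ∈ nonnegPart a :=
  single_mem_nonnegPart (zero_mem _) hr

lemma sum_single_mem_nonnegPart (s : Finset (Fin m)) :
    ∑ j ∈ s, AddMonoidAlgebra.single (a j) (1 : ℝ) ∈ nonnegPart a := by
  refine Finset.sum_induction _ (· ∈ nonnegPart a) (fun _ _ => add_mem_nonnegPart) ?_ fun j _ =>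
    single_mem_nonnegPart (AddSubmonoid.subset_closure ⟨j, rfl⟩) zero_le_one
  simpa using algebraMap_mem_nonnegPart (a := a) le_rfl

lemma single_mem_monomialSubalgebra {b : Fin n → ℤ}
    (hb : b ∈ AddSubmonoid.closure (Set.range a)) (r : ℝ) :
    AddMonoidAlgebra.single b r ∈ monomialSubalgebra a := by
  suffices h : AddMonoidAlgebra.single b (1 : ℝ) ∈ monomialSubalgebra a by
    simpa using (monomialSubalgebra a).smul_mem h r
  induction hb using AddSubmonoid.closure_induction with
  | mem _ h =>
    obtain ⟨j, rfl⟩ := h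
    exact Algebra.subset_adjoin ⟨j, rfl⟩
  | zero => exact one_mem _
  | add _ _ _ _ hx hy => simpa using mul_mem hx hy

lemma nonnegPart_subset_monomialSubalgebra :
    nonnegPart a ⊆ (monomialSubalgebra a : Set (AddMonoidAlgebra ℝ (Fin n → ℤ))) := by
  intro g hg
  rw [← g.sum_coeff_single]
  exact sum_mem fun b hb => single_mem_monomialSubalgebra (hg.2 hb) _

lemma polyaMul_mem_monomialSubalgebra : polyaMul a ∈ monomialSubalgebra a :=
  nonnegPart_subset_monomialSubalgebra (sum_single_mem_nonnegPart _)

lemma nonnegPart_subset_polyaPreprime : nonnegPart a ⊆ polyaPreprime a :=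
  fun g hg => ⟨g, hg, 0, zero_mem _, by simp⟩

lemma add_mem_polyaPreprime (hp : p ∈ polyaPreprime a) (hq : q ∈ polyaPreprime a) :
    p + q ∈ polyaPreprime a := by
  obtain ⟨g, hg, h, hh, rfl⟩ := hp
  obtain ⟨g', hg', h', hh', rfl⟩ := hq
  exact ⟨g + g', add_mem_nonnegPart hg hg', h + h', add_mem hh hh', by ring⟩

lemma mul_mem_polyaPreprime (hp : p ∈ polyaPreprime a) (hq : q ∈ polyaPreprime a) :
    p * q ∈ polyaPreprime a := by
  obtain ⟨g, hg, h, hh, rfl⟩ := hp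
  obtain ⟨g', hg', h', hh', rfl⟩ := hq
  have hgR := nonnegPart_subset_monomialSubalgebra hg
  have hgR' := nonnegPart_subset_monomialSubalgebra hg'
  exact ⟨g * g', mul_mem_nonnegPart hg hg', g * h' + h * g' + h * h' * (1 - polyaMul a),
    add_mem (add_mem (mul_mem hgR hh') (mul_mem hh hgR'))
      (mul_mem (mul_mem hh hh') (sub_mem (one_mem _) polyaMul_mem_monomialSubalgebra)), by ring⟩

lemma algebraMap_mem_polyaPreprime {r : ℝ} (hr : 0 ≤ r) :
    algebraMap ℝ (AddMonoidAlgebra ℝ (Fin n → ℤ)) r ∈ polyaPreprime a :=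
  nonnegPart_subset_polyaPreprime (algebraMap_mem_nonnegPart hr)

lemma one_sub_single_mem_polyaPreprime (j : Fin m) :
    1 - AddMonoidAlgebra.single (a j) (1 : ℝ) ∈ polyaPreprime a := by
  refine ⟨_, sum_single_mem_nonnegPart (Finset.univ.erase j), 1, one_mem _, ?_⟩
  rw [polyaMul, ← Finset.add_sum_erase _ _ (Finset.mem_univ j)]
  ring

lemma mem_polyaPreprime_of_add_self (hp : p + p ∈ polyaPreprime a) : p ∈ polyaPreprime a := by
  have h := mul_mem_polyaPreprime
    (algebraMap_mem_polyaPreprime (a := a) (by norm_num : (0 : ℝ) ≤ 1 / 2)) hp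
  rwa [← Algebra.smul_def, ← two_smul ℝ p, smul_smul, one_div, inv_mul_cancel₀ two_ne_zero,
    one_smul] at h

lemma exists_nat_add_sub_mem_polyaPreprime (hp : p ∈ monomialSubalgebra a) :
    ∃ N : ℕ, (N : AddMonoidAlgebra ℝ (Fin n → ℤ)) + p ∈ polyaPreprime a ∧
      (N : AddMonoidAlgebra ℝ (Fin n → ℤ)) - p ∈ polyaPreprime a := by
  induction hp using Algebra.adjoin_induction with
  | mem _ h =>
    obtain ⟨j, rfl⟩ := h
    refine ⟨1, ?_, by simpa using one_sub_single_mem_polyaPreprime j⟩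
    refine add_mem_polyaPreprime ?_ (nonnegPart_subset_polyaPreprime
      (single_mem_nonnegPart (AddSubmonoid.subset_closure ⟨j, rfl⟩) zero_le_one))
    simpa only [Nat.cast_one, map_one] using algebraMap_mem_polyaPreprime (a := a) zero_le_one
  | algebraMap r =>
    obtain ⟨N, hN⟩ := exists_nat_ge |r|
    refine ⟨N, ?_, ?_⟩
    · rw [← map_natCast (algebraMap ℝ _), ← map_add]
      exact algebraMap_mem_polyaPreprime (by linarith [neg_abs_le r])
    · rw [← map_natCast (algebraMap ℝ _), ← map_sub]
      exact algebraMap_mem_polyaPreprime (by linarith [le_abs_self r])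
  | add x y _ _ hx hy =>
    obtain ⟨N, hN, hN'⟩ := hx
    obtain ⟨M, hM, hM'⟩ := hy
    refine ⟨N + M, ?_, ?_⟩
    · convert add_mem_polyaPreprime hN hM using 1
      push_cast
      ring
    · convert add_mem_polyaPreprime hN' hM' using 1
      push_cast
      ring
  | mul x y _ _ hx hy =>
    obtain ⟨N, hN, hN'⟩ := hx
    obtain ⟨M, hM, hM'⟩ := hy
    refine ⟨N * M, mem_polyaPreprime_of_add_self ?_, mem_polyaPreprime_of_add_self ?_⟩
    · convert add_mem_polyaPreprime (mul_mem_polyaPreprime hN hM)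
        (mul_mem_polyaPreprime hN' hM') using 1
      push_cast
      ring
    · convert add_mem_polyaPreprime (mul_mem_polyaPreprime hN hM')
        (mul_mem_polyaPreprime hN' hM) using 1
      push_cast
      ring

end

/-- Lemma 3.3: `T` is an Archimedean preprime of `R`. -/
theorem polyaPreprime_isArchimedeanPreprime
    {n m : ℕ} (hn : 1 ≤ n) (hm : 1 ≤ m) (a : Fin m → Fin n → ℤ) :
    (∀ p ∈ polyaPreprime a, ∀ q ∈ polyaPreprime a, p + q ∈ polyaPreprime a) ∧
    (∀ p ∈ polyaPreprime a, ∀ q ∈ polyaPreprime a, p * q ∈ polyaPreprime a) ∧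
    (∀ q : ℚ, 0 ≤ q →
      algebraMap ℝ (AddMonoidAlgebra ℝ (Fin n → ℤ)) (q : ℝ) ∈ polyaPreprime a) ∧
    (∀ f ∈ monomialSubalgebra a, ∃ N : ℕ,
      (N : AddMonoidAlgebra ℝ (Fin n → ℤ)) + f ∈ polyaPreprime a ∧
      (N : AddMonoidAlgebra ℝ (Fin n → ℤ)) - f ∈ polyaPreprime a) := by
  exact ⟨fun _ hp _ hq => add_mem_polyaPreprime hp hq,
    fun _ hp _ hq => mul_mem_polyaPreprime hp hq,
    fun _ hq => algebraMap_mem_polyaPreprime (by exact_mod_cast hq),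
    fun _ hf => exists_nat_add_sub_mem_polyaPreprime hf⟩
end
end
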